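/- Fix an integer n ≥ 1. For every continuous compactly supported function f : ℝ^n → ℝ, lim_{N→∞} ∫_{ℝ^n} f(t_1,…,t_n) (1/(2N^{2/3}))^n R^{BT}_{n2}(1+t_1/(2N^{2/3}),…,1+t_n/(2N^{2/3})) dt_1⋯dt_n = ∫_{ℝ^n} f(t_1,…,t_n) det[K_Airy(t_j,t_k)]_{j,k=1}^n dt_1⋯dt_n. (Airy-kernel universality at the soft edge for the bounded trace Gaussian unitary ensemble.) -/

import Mathlib

open MeasureTheory Filter Real Topology

noncomputable section

/-- The β-Vandermonde factor `∏_{j<k} |x_j - x_k|^β`. -/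
def vand (β : ℝ) (N : ℕ) (x : Fin N → ℝ) : ℝ :=
  ∏ p ∈ Finset.univ.filter (fun p : Fin N × Fin N => p.1 < p.2), |x p.1 - x p.2| ^ β

/-- `N_β = N + βN(N-1)/2`. -/
def Nbeta (β : ℝ) (N : ℕ) : ℝ := N + β * N * (N - 1) / 2

/-- Surface (Hausdorff) measure on the sphere of radius `r` in Euclidean `ℝ^N`. -/
def sphereMeasure (N : ℕ) (r : ℝ) : Measure (EuclideanSpace ℝ (Fin N)) :=
  (μH[(N : ℝ) - 1]).restrict (Metric.sphere (0 : EuclideanSpace ℝ (Fin N)) r)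

/-- Normalization of the fixed trace ensemble: total `Δ_β`-mass of the sphere of radius `r`. -/
def Zft (β : ℝ) (N : ℕ) (r : ℝ) : ℝ :=
  ∫ x, vand β N x ∂(sphereMeasure N r)

/-- Glue `(x_1,…,x_n)` and `(x_{n+1},…,x_N)` into a vector in `ℝ^N`. -/
def combine (N n : ℕ) (x : Fin n → ℝ) (y : Fin (N - n) → ℝ) : Fin N → ℝ := fun i =>
  if h : (i : ℕ) < n then x ⟨i, h⟩
  else y ⟨(i : ℕ) - n, by have := i.isLt; omega⟩

/-- `n`-point correlation function of the fixed trace Gaussian β-ensemble of strength `r`. -/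
def Rft (β : ℝ) (n N : ℕ) (r : ℝ) (x : Fin n → ℝ) : ℝ :=
  ((N.factorial : ℝ) / ((N - n).factorial : ℝ)) * (Zft β N r)⁻¹ *
    ∫ y, vand β N (combine N n x y)
      ∂(sphereMeasure (N - n) (Real.sqrt (r ^ 2 - ∑ i, x i ^ 2)))

/-- Normalization of the bounded trace ensemble. -/
def Zbt (β : ℝ) (N : ℕ) (r : ℝ) : ℝ :=
  ∫ x : Fin N → ℝ, Set.indicator {z : Fin N → ℝ | ∑ i, z i ^ 2 ≤ r ^ 2} (vand β N) x

/-- `n`-point correlation function of the bounded trace Gaussian β-ensemble of strength `r`. -/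
def Rbt (β : ℝ) (n N : ℕ) (r : ℝ) (x : Fin n → ℝ) : ℝ :=
  ((N.factorial : ℝ) / ((N - n).factorial : ℝ)) * (Zbt β N r)⁻¹ *
    ∫ y : Fin (N - n) → ℝ,
      Set.indicator {z : Fin N → ℝ | ∑ i, z i ^ 2 ≤ r ^ 2} (vand β N) (combine N n x y)

/-- Normalization of the (unconstrained) Gaussian β-ensemble. -/
def Zg (β : ℝ) (N : ℕ) : ℝ :=
  ∫ x : Fin N → ℝ, vand β N x * ∏ i, Real.exp (-(β * N * x i ^ 2))

/-- `n`-point correlation function of the Gaussian β-ensemble. -/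
def Rg (β : ℝ) (n N : ℕ) (x : Fin n → ℝ) : ℝ :=
  ((N.factorial : ℝ) / ((N - n).factorial : ℝ)) * (Zg β N)⁻¹ *
    ∫ y : Fin (N - n) → ℝ,
      vand β N (combine N n x y) * ∏ i, Real.exp (-(β * N * (combine N n x y i) ^ 2))

/-- The sine kernel `sin(π(x-y))/(π(x-y))`, with value `1` on the diagonal. -/
def Ksine (x y : ℝ) : ℝ :=
  if x = y then 1 else Real.sin (π * (x - y)) / (π * (x - y))

/-- `S(t) = sin(πt)/(πt)` with `S(0) = 1`. -/
def Ssin (t : ℝ) : ℝ := if t = 0 then 1 else Real.sin (π * t) / (π * t)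

/-- The 2×2 matrix sine kernel for β = 1. -/
def K1sine (x y : ℝ) : Fin 2 → Fin 2 → ℝ :=
  ![![Ssin (x - y), deriv Ssin (x - y)],
    ![(∫ t in (0:ℝ)..(x - y), Ssin t) - Real.sign (x - y) / 2, Ssin (x - y)]]

/-- The 2×2 matrix sine kernel for β = 4. -/
def K4sine (x y : ℝ) : Fin 2 → Fin 2 → ℝ :=
  ![![Ssin (2 * (x - y)), deriv (fun z => Ssin (2 * (z - y))) x],
    ![(∫ t in (0:ℝ)..(x - y), Ssin (2 * t)) - Real.sign (2 * (x - y)) / 2,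
      Ssin (2 * (x - y))]]

/-- The Airy function `Ai(x) = lim_{T→∞} (1/π) ∫_0^T cos(t³/3 + xt) dt`. -/
def Ai (x : ℝ) : ℝ :=
  limUnder atTop (fun T : ℝ => (1 / π) * ∫ t in (0:ℝ)..T, Real.cos (t ^ 3 / 3 + x * t))

/-- The Airy kernel. -/
def KAiry (x y : ℝ) : ℝ :=
  if x = y then (deriv Ai x) ^ 2 - x * (Ai x) ^ 2
  else (Ai x * deriv Ai y - deriv Ai x * Ai y) / (x - y)

/-- `C_{Nβ} = Γ(N_β/2)·2^{N_β/2−1}·β^{−N_β/2}`. -/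
def Cnb (β : ℝ) (N : ℕ) : ℝ :=
  Real.Gamma (Nbeta β N / 2) * (2 : ℝ) ^ (Nbeta β N / 2 - 1) * β ^ (-(Nbeta β N) / 2)

end

/-- The integrand of the Airy contour integral on the line `Re v = 1`. -/
noncomputable def airyIntegrand (x u : ℝ) : ℂ :=
  Complex.exp ((1 + u * Complex.I) ^ 3 / 3 - x * (1 + u * Complex.I))

/-- Moments of the Airy contour integrand. -/
noncomputable def airyMoment (k : ℕ) (x : ℝ) : ℂ :=
  ∫ u : ℝ, (1 + u * Complex.I) ^ k * airyIntegrand x u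

lemma norm_airyIntegrand (x u : ℝ) :
    ‖airyIntegrand x u‖ = Real.exp (1 / 3 - x - u ^ 2) := by
  rw [airyIntegrand, Complex.norm_exp]
  congr 1
  have : ((1 : ℂ) + u * Complex.I) ^ 3 / 3 - x * (1 + u * Complex.I)
      = ((1 / 3 - x - u ^ 2 : ℝ) : ℂ) + ((u - u ^ 3 / 3 - x * u : ℝ) : ℂ) * Complex.I := by
    have h2 := Complex.I_sq
    push_cast
    linear_combination (↑u ^ 2 + ↑u ^ 3 * Complex.I / 3) * h2
  rw [this]
  simp only [Complex.add_re, Complex.ofReal_re, Complex.re_ofReal_mul, Complex.I_re, mul_zero,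
    add_zero]

lemma continuous_airyMomentIntegrand (k : ℕ) (x : ℝ) :
    Continuous fun u : ℝ => ((1 : ℂ) + u * Complex.I) ^ k * airyIntegrand x u := by
  unfold airyIntegrand
  fun_prop

lemma norm_one_add_mul_I_sq (u : ℝ) : ‖(1 : ℂ) + u * Complex.I‖ ^ 2 = 1 + u ^ 2 := by
  rw [← Complex.normSq_eq_norm_sq]
  simp [Complex.normSq_apply]
  ring

lemma norm_airyMomentIntegrand_le {k : ℕ} (hk : k ≤ 2) (x u : ℝ) :
    ‖((1 : ℂ) + u * Complex.I) ^ k * airyIntegrand x u‖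
      ≤ 2 * Real.exp (1 / 3 - x) * Real.exp (-(1 / 2) * u ^ 2) := by
  have h1 : 1 ≤ ‖(1 : ℂ) + u * Complex.I‖ := by
    have := norm_one_add_mul_I_sq u
    nlinarith [sq_nonneg u, norm_nonneg ((1 : ℂ) + u * Complex.I)]
  have h2 : ‖(1 : ℂ) + u * Complex.I‖ ^ k ≤ 2 * Real.exp (u ^ 2 / 2) := by
    refine (pow_le_pow_right₀ h1 hk).trans ?_
    rw [norm_one_add_mul_I_sq]
    nlinarith [Real.add_one_le_exp (u ^ 2 / 2), sq_nonneg u]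
  rw [norm_mul, norm_pow, norm_airyIntegrand]
  calc _ ≤ 2 * Real.exp (u ^ 2 / 2) * Real.exp (1 / 3 - x - u ^ 2) := by gcongr
    _ = _ := by
      rw [mul_assoc, mul_assoc, ← Real.exp_add, ← Real.exp_add]
      congr 2
      ring

lemma integrable_airyMomentIntegrand {k : ℕ} (hk : k ≤ 2) (x : ℝ) :
    Integrable fun u : ℝ => ((1 : ℂ) + u * Complex.I) ^ k * airyIntegrand x u := by
  refine Integrable.mono' ((integrable_exp_neg_mul_sq (b := 1 / 2) (by norm_num)).const_mul
    (2 * Real.exp (1 / 3 - x))) (continuous_airyMomentIntegrand k x).aestronglyMeasurable ?_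
  exact Eventually.of_forall fun u => norm_airyMomentIntegrand_le hk x u

lemma norm_airyMoment_le {k : ℕ} (hk : k ≤ 2) (x : ℝ) :
    ‖airyMoment k x‖ ≤ 2 * Real.exp (1 / 3) * √(2 * π) * Real.exp (-x) := by
  have h := norm_integral_le_of_norm_le ((integrable_exp_neg_mul_sq (b := 1 / 2)
    (by norm_num)).const_mul (2 * Real.exp (1 / 3 - x)))
    (Eventually.of_forall fun u => norm_airyMomentIntegrand_le hk x u)
  refine h.trans (le_of_eq ?_)
  rw [integral_const_mul, integral_gaussian, sub_eq_add_neg, Real.exp_add]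
  have : π / (1 / 2) = 2 * π := by ring
  rw [this]
  ring

lemma hasDerivAt_airyMoment {k : ℕ} (hk : k ≤ 1) (x : ℝ) :
    HasDerivAt (airyMoment k) (-airyMoment (k + 1) x) x := by
  have key := hasDerivAt_integral_of_dominated_loc_of_deriv_le (μ := volume)
    (F := fun (x : ℝ) (u : ℝ) => ((1 : ℂ) + u * Complex.I) ^ k * airyIntegrand x u)
    (F' := fun (x : ℝ) (u : ℝ) => -(((1 : ℂ) + u * Complex.I) ^ (k + 1) * airyIntegrand x u))
    (x₀ := x) (s := Metric.ball x 1)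
    (bound := fun u => 2 * Real.exp (1 / 3 - (x - 1)) * Real.exp (-(1 / 2) * u ^ 2))
    (Metric.ball_mem_nhds x one_pos)
    (Eventually.of_forall fun y => (continuous_airyMomentIntegrand k y).aestronglyMeasurable)
    (integrable_airyMomentIntegrand (by omega) x)
    (continuous_airyMomentIntegrand (k + 1) x).neg.aestronglyMeasurable
    (Eventually.of_forall fun u y hy => by
      rw [norm_neg]
      refine (norm_airyMomentIntegrand_le (by omega) y u).trans ?_
      rw [Metric.mem_ball, Real.dist_eq, abs_lt] at hy
      gcongr
      linarith)
    ((integrable_exp_neg_mul_sq (b := 1 / 2) (by norm_num)).const_mul _)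
    (Eventually.of_forall fun u y _ => by
      unfold airyIntegrand
      have h1 : HasDerivAt (fun y : ℝ => ((1 : ℂ) + u * Complex.I) ^ 3 / 3
          - y * (1 + u * Complex.I)) (-(1 * (1 + u * Complex.I))) y :=
        ((Complex.ofRealCLM.hasDerivAt (x := y)).mul_const _).const_sub _
      refine (h1.cexp.const_mul (((1 : ℂ) + u * Complex.I) ^ k)).congr_deriv ?_
      ring)
  have h2 := key.2
  rw [integral_neg] at h2
  exact h2

lemma airyMoment_two (x : ℝ) : airyMoment 2 x = x * airyMoment 0 x := by
  have hd : ∀ u : ℝ, HasDerivAt (airyIntegrand x)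
      (Complex.I * ((1 + u * Complex.I) ^ 2 * airyIntegrand x u
        - x * ((1 + u * Complex.I) ^ 0 * airyIntegrand x u))) u := by
    intro u
    unfold airyIntegrand
    have h0 : HasDerivAt (fun u : ℝ => (1 : ℂ) + u * Complex.I) (1 * Complex.I) u :=
      ((Complex.ofRealCLM.hasDerivAt (x := u)).mul_const _).const_add _
    have h1 : HasDerivAt (fun u : ℝ => ((1 : ℂ) + u * Complex.I) ^ 3 / 3
          - x * (1 + u * Complex.I)) _ u := ((h0.pow 3).div_const 3).sub (h0.const_mul (x : ℂ))
    convert h1.cexp using 1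
    push_cast
    ring
  have ht : Tendsto (fun u : ℝ => Real.exp (1 / 3 - x - u ^ 2)) (cocompact ℝ) (𝓝 0) := by
    refine Real.tendsto_exp_atBot.comp ?_
    refine tendsto_atBot_add_const_left _ _ ?_ |>.congr (fun u => (sub_eq_add_neg _ _).symm)
    refine tendsto_neg_atTop_atBot.comp ?_
    have := (tendsto_pow_atTop (α := ℝ) two_ne_zero).comp (tendsto_norm_cocompact_atTop (E := ℝ))
    refine this.congr fun u => by simp
  have ht' : Tendsto (airyIntegrand x) (cocompact ℝ) (𝓝 0) := by
    rw [tendsto_zero_iff_norm_tendsto_zero]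
    simpa only [norm_airyIntegrand] using ht
  rw [cocompact_eq_atBot_atTop, tendsto_sup] at ht'
  have i2 := integrable_airyMomentIntegrand (k := 2) le_rfl x
  have i0 := (integrable_airyMomentIntegrand (k := 0) (by norm_num) x).const_mul (x : ℂ)
  have h := integral_of_hasDerivAt_of_tendsto hd ((i2.sub i0).const_mul _) ht'.1 ht'.2
  rw [integral_const_mul, integral_sub i2 i0, integral_const_mul, sub_zero] at h
  rcases mul_eq_zero.1 h with h | h
  · exact absurd h Complex.I_ne_zero
  · exact sub_eq_zero.1 h

lemma intervalIntegral_cos_eq_re (x T : ℝ) :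
    (1 / π) * ∫ t in (0:ℝ)..T, Real.cos (t ^ 3 / 3 + x * t) =
      (1 / (2 * π)) * (∫ u in (-T)..T, Complex.exp (((u * Complex.I : ℂ)) ^ 3 / 3
        - x * (u * Complex.I))).re := by
  have h1 : (∫ u in (-T)..T, Complex.exp (((u * Complex.I : ℂ)) ^ 3 / 3
        - x * (u * Complex.I))).re = ∫ u in (-T)..T, Real.cos (u ^ 3 / 3 + x * u) := by
    have hi : IntervalIntegrable (fun u : ℝ => Complex.exp (((u * Complex.I : ℂ)) ^ 3 / 3
        - x * (u * Complex.I))) volume (-T) T := by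
      apply Continuous.intervalIntegrable
      fun_prop
    have := Complex.reCLM.intervalIntegral_comp_comm hi
    simp only [Complex.reCLM_apply] at this
    rw [← this]
    refine intervalIntegral.integral_congr fun u _ => ?_
    have h : (((u * Complex.I : ℂ)) ^ 3 / 3 - x * (u * Complex.I))
        = ((-(u ^ 3 / 3 + x * u) : ℝ) : ℂ) * Complex.I := by
      push_cast
      linear_combination (↑u ^ 3 * Complex.I / 3) * Complex.I_sq
    simp only [h]
    rw [Complex.exp_ofReal_mul_I_re, Real.cos_neg]
  have hc : Continuous fun u : ℝ => Real.cos (u ^ 3 / 3 + x * u) := by fun_prop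
  rw [h1, ← intervalIntegral.integral_add_adjacent_intervals (a := -T) (b := 0) (c := T)
    (hc.intervalIntegrable _ _) (hc.intervalIntegrable _ _)]
  have h2 : ∫ u in (-T)..0, Real.cos (u ^ 3 / 3 + x * u)
      = ∫ u in (0:ℝ)..T, Real.cos (u ^ 3 / 3 + x * u) := by
    have := intervalIntegral.integral_comp_neg (a := 0) (b := T)
      (fun u : ℝ => Real.cos (u ^ 3 / 3 + x * u))
    rw [neg_zero] at this
    rw [← this]
    refine intervalIntegral.integral_congr fun u _ => ?_
    rw [← Real.cos_neg]
    congr 1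
    ring
  rw [h2]
  field_simp
  ring

lemma norm_airy_side_le (x T : ℝ) {s : ℝ} (hs : s ∈ Set.Icc (0:ℝ) 1) :
    ‖Complex.exp ((s + T * Complex.I) ^ 3 / 3 - x * (s + T * Complex.I))‖
      ≤ Real.exp (1 + |x|) * Real.exp (-T ^ 2 * s) := by
  rw [Complex.norm_exp, ← Real.exp_add]
  have : ((s : ℂ) + T * Complex.I) ^ 3 / 3 - x * (s + T * Complex.I)
      = ((s ^ 3 / 3 - x * s - T ^ 2 * s : ℝ) : ℂ)
        + ((s ^ 2 * T - T ^ 3 / 3 - x * T : ℝ) : ℂ) * Complex.I := by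
    have h2 := Complex.I_sq
    push_cast
    linear_combination (↑s * ↑T ^ 2 + ↑T ^ 3 * Complex.I / 3) * h2
  rw [this]
  simp only [Complex.add_re, Complex.ofReal_re, Complex.re_ofReal_mul, Complex.I_re, mul_zero,
    add_zero, Real.exp_le_exp]
  have h3 : s ^ 3 ≤ 1 := pow_le_one₀ hs.1 hs.2
  have h4 : -(x * s) ≤ |x| := by
    rw [← neg_mul]
    calc -x * s ≤ |x| * s := by
          have := hs.1
          gcongr
          exact neg_le_abs x
      _ ≤ |x| * 1 := by
        have := hs.2
        gcongr
      _ = |x| := mul_one _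
  linarith


lemma tendsto_airy_side (x : ℝ) {l : Filter ℝ} [l.IsCountablyGenerated]
    (hl : Tendsto (fun T : ℝ => T ^ 2) l atTop) :
    Tendsto (fun T : ℝ => ∫ s in (0:ℝ)..1,
      Complex.exp ((s + T * Complex.I) ^ 3 / 3 - x * (s + T * Complex.I))) l (𝓝 0) := by
  have h := intervalIntegral.tendsto_integral_filter_of_dominated_convergence (μ := volume)
    (a := 0) (b := 1) (l := l)
    (F := fun (T : ℝ) (s : ℝ) =>
      Complex.exp ((s + T * Complex.I) ^ 3 / 3 - x * (s + T * Complex.I)))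
    (f := fun _ => 0) (fun _ => Real.exp (1 + |x|))
    (Eventually.of_forall fun T => by
      apply Continuous.aestronglyMeasurable
      fun_prop)
    (Eventually.of_forall fun T => Eventually.of_forall fun s hs => by
      rw [Set.uIoc_of_le zero_le_one] at hs
      refine (norm_airy_side_le x T ⟨hs.1.le, hs.2⟩).trans ?_
      refine mul_le_of_le_one_right (Real.exp_nonneg _) (Real.exp_le_one_iff.2 ?_)
      nlinarith [hs.1, sq_nonneg T])
    intervalIntegrable_const
    (Eventually.of_forall fun s hs => by
      rw [Set.uIoc_of_le zero_le_one] at hs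
      have hz : Tendsto (fun T : ℝ => Real.exp (1 + |x|) * Real.exp (-T ^ 2 * s)) l (𝓝 0) := by
        rw [← mul_zero (Real.exp (1 + |x|))]
        refine (Real.tendsto_exp_atBot.comp ?_).const_mul _
        refine (tendsto_neg_atTop_atBot.comp (hl.atTop_mul_const hs.1)).congr fun T => ?_
        simp
      exact squeeze_zero_norm (fun T => norm_airy_side_le x T ⟨hs.1.le, hs.2⟩) hz)
  simpa using h

lemma tendsto_airy_integral (x : ℝ) :
    Tendsto (fun T : ℝ => (1 / π) * ∫ t in (0:ℝ)..T, Real.cos (t ^ 3 / 3 + x * t)) atTop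
      (𝓝 ((1 / (2 * π)) * (airyMoment 0 x).re)) := by
  simp_rw [intervalIntegral_cos_eq_re]
  refine Tendsto.const_mul _ ((Complex.continuous_re.tendsto _).comp ?_)
  have hsq : Tendsto (fun T : ℝ => T ^ 2) atTop atTop := tendsto_pow_atTop two_ne_zero
  have hp := tendsto_airy_side x hsq
  have hm : Tendsto (fun T : ℝ => ∫ s in (0:ℝ)..1,
      Complex.exp ((s + (-T : ℝ) * Complex.I) ^ 3 / 3 - x * (s + (-T : ℝ) * Complex.I))) atTop
      (𝓝 0) := by
    refine (tendsto_airy_side x (l := atBot) ?_).comp tendsto_neg_atTop_atBot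
    have := hsq.comp tendsto_neg_atBot_atTop
    exact this.congr fun T => by simp
  have hmain : Tendsto (fun T : ℝ => ∫ u in (-T)..T, airyIntegrand x u) atTop
      (𝓝 (airyMoment 0 x)) := by
    have hi := integrable_airyMomentIntegrand (k := 0) (by norm_num) x
    have := intervalIntegral_tendsto_integral hi tendsto_neg_atTop_atBot tendsto_id
    simpa [airyMoment] using this
  have key : ∀ T : ℝ, ∫ u in (-T)..T, Complex.exp (((u * Complex.I : ℂ)) ^ 3 / 3
        - x * (u * Complex.I)) = (∫ u in (-T)..T, airyIntegrand x u)
      + Complex.I * ((∫ s in (0:ℝ)..1,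
      Complex.exp ((s + T * Complex.I) ^ 3 / 3 - x * (s + T * Complex.I)))
        - ∫ s in (0:ℝ)..1,
      Complex.exp ((s + (-T : ℝ) * Complex.I) ^ 3 / 3 - x * (s + (-T : ℝ) * Complex.I))) := by
    intro T
    have hd : Differentiable ℂ fun v : ℂ => Complex.exp (v ^ 3 / 3 - x * v) := by fun_prop
    have h := Complex.integral_boundary_rect_eq_zero_of_differentiableOn
      (fun v : ℂ => Complex.exp (v ^ 3 / 3 - x * v)) ⟨0, -T⟩ ⟨1, T⟩ hd.differentiableOn
    simp only [smul_eq_mul, Complex.ofReal_zero, zero_add, Complex.ofReal_one] at h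
    simp only [airyIntegrand]
    linear_combination Complex.I * h + ((∫ u in (-T)..T, Complex.exp (((u * Complex.I : ℂ)) ^ 3 / 3
        - x * (u * Complex.I))) - ∫ u in (-T)..T, Complex.exp ((1 + u * Complex.I) ^ 3 / 3
        - x * (1 + u * Complex.I))) * Complex.I_sq
  simp_rw [key]
  simpa using hmain.add ((hp.sub hm).const_mul Complex.I)

lemma Ai_eq (x : ℝ) : Ai x = (1 / (2 * π)) * (airyMoment 0 x).re :=
  (tendsto_airy_integral x).limUnder_eq

/-- The derivative of the Airy function as a contour integral. -/
noncomputable def AiDeriv (x : ℝ) : ℝ := -((1 / (2 * π)) * (airyMoment 1 x).re)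

lemma hasDerivAt_Ai (x : ℝ) : HasDerivAt Ai (AiDeriv x) x := by
  have h := ((Complex.reCLM.hasFDerivAt.comp_hasDerivAt x
    (hasDerivAt_airyMoment (k := 0) (by norm_num) x)).const_mul (1 / (2 * π)))
  have h' := h.congr_of_eventuallyEq (f₁ := Ai) (Eventually.of_forall fun y => by
    simp [Ai_eq])
  refine h'.congr_deriv ?_
  simp [AiDeriv]

lemma hasDerivAt_AiDeriv (x : ℝ) : HasDerivAt AiDeriv (x * Ai x) x := by
  have h := ((Complex.reCLM.hasFDerivAt.comp_hasDerivAt x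
    (hasDerivAt_airyMoment (k := 1) le_rfl x)).const_mul (1 / (2 * π))).neg
  have h' := h.congr_of_eventuallyEq (f₁ := AiDeriv) (Eventually.of_forall fun y => by
    simp [AiDeriv])
  refine h'.congr_deriv ?_
  simp [airyMoment_two, Ai_eq]
  ring

lemma deriv_Ai : deriv Ai = AiDeriv := funext fun x => (hasDerivAt_Ai x).deriv

lemma exists_abs_Ai_le : ∃ C : ℝ, 0 ≤ C ∧ ∀ x, |Ai x| ≤ C * Real.exp (-x) ∧
    |AiDeriv x| ≤ C * Real.exp (-x) := by
  refine ⟨(1 / (2 * π)) * (2 * Real.exp (1 / 3) * √(2 * π)), by positivity, fun x => ⟨?_, ?_⟩⟩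
  · rw [Ai_eq, abs_mul, abs_of_pos (by positivity : 0 < 1 / (2 * π)), mul_assoc (1 / (2 * π))]
    gcongr
    exact (Complex.abs_re_le_norm _).trans (norm_airyMoment_le (by norm_num) x)
  · rw [AiDeriv, abs_neg, abs_mul, abs_of_pos (by positivity : 0 < 1 / (2 * π)),
      mul_assoc (1 / (2 * π))]
    gcongr
    exact (Complex.abs_re_le_norm _).trans (norm_airyMoment_le (by norm_num) x)

lemma continuous_Ai : Continuous Ai :=
  continuous_iff_continuousAt.2 fun x => (hasDerivAt_Ai x).continuousAt

lemma hasDerivAt_KAiry_diag (x y s : ℝ) :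
    HasDerivAt (fun s => KAiry (x + s) (y + s)) (-(Ai (x + s) * Ai (y + s))) s := by
  have hA : ∀ z : ℝ, HasDerivAt (fun s => Ai (z + s)) (AiDeriv (z + s)) s := fun z =>
    (hasDerivAt_Ai (z + s)).comp_const_add z s
  have hB : ∀ z : ℝ, HasDerivAt (fun s => AiDeriv (z + s)) ((z + s) * Ai (z + s)) s := fun z =>
    (hasDerivAt_AiDeriv (z + s)).comp_const_add z s
  by_cases hxy : x = y
  · subst hxy
    simp only [KAiry, if_true, deriv_Ai]
    refine (((hB x).pow 2).sub (((hasDerivAt_id s).const_add x).mul ((hA x).pow 2))).congr_deriv ?_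
    simp
    ring
  · have hne : ∀ s, x + s ≠ y + s := fun s h => hxy (by linarith)
    simp only [KAiry, if_neg (hne _), deriv_Ai]
    have hsub : x - y ≠ 0 := sub_ne_zero.2 hxy
    have : ∀ s, x + s - (y + s) = x - y := fun s => by ring
    simp only [this]
    refine ((((hA x).mul (hB y)).sub ((hB x).mul (hA y))).div_const (x - y)).congr_deriv ?_
    field_simp
    ring

lemma tendsto_KAiry_diag (x y : ℝ) :
    Tendsto (fun s => KAiry (x + s) (y + s)) atTop (𝓝 0) := by
  obtain ⟨C, hC, hb⟩ := exists_abs_Ai_le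
  have hA0 : ∀ z : ℝ, Tendsto (fun s => C * Real.exp (-(z + s))) atTop (𝓝 0) := by
    intro z
    rw [← mul_zero C]
    refine (Real.tendsto_exp_atBot.comp (tendsto_neg_atTop_atBot.comp
      (tendsto_atTop_add_const_left _ z tendsto_id))).const_mul C
  have hA : ∀ z : ℝ, Tendsto (fun s => Ai (z + s)) atTop (𝓝 0) := fun z =>
    squeeze_zero_norm (fun s => (hb (z + s)).1) (hA0 z)
  have hB : ∀ z : ℝ, Tendsto (fun s => AiDeriv (z + s)) atTop (𝓝 0) := fun z =>
    squeeze_zero_norm (fun s => (hb (z + s)).2) (hA0 z)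
  by_cases hxy : x = y
  · subst hxy
    simp only [KAiry, if_true, deriv_Ai]
    have h3 : Tendsto (fun s => (x + s) * Ai (x + s)) atTop (𝓝 0) := by
      have hp := (Real.tendsto_pow_mul_exp_neg_atTop_nhds_zero 1).comp
        (tendsto_atTop_add_const_left atTop x tendsto_id)
      have hp' := (hp.abs).const_mul C
      simp only [abs_zero, mul_zero] at hp'
      refine squeeze_zero_norm (fun s => ?_) hp'
      simp only [Function.comp, id, pow_one, norm_mul, Real.norm_eq_abs, abs_mul, Real.abs_exp]
      nlinarith [(hb (x + s)).1, abs_nonneg (x + s)]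
    have := ((hB x).pow 2).sub (h3.mul (hA x))
    simp only [ne_eq, OfNat.ofNat_ne_zero, not_false_eq_true, zero_pow, mul_zero, sub_zero] at this
    refine this.congr fun s => by ring
  · have hne : ∀ s, x + s ≠ y + s := fun s h => hxy (by linarith)
    simp only [KAiry, if_neg (hne _), deriv_Ai]
    have : ∀ s, x + s - (y + s) = x - y := fun s => by ring
    simp only [this]
    simpa using (((hA x).mul (hB y)).sub ((hB x).mul (hA y))).div_const (x - y)

lemma KAiry_eq_integral (x y : ℝ) :
    KAiry x y = ∫ s in Set.Ioi (0:ℝ), Ai (x + s) * Ai (y + s) := by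
  obtain ⟨C, hC, hb⟩ := exists_abs_Ai_le
  have hInt : IntegrableOn (fun s => -(Ai (x + s) * Ai (y + s))) (Set.Ioi 0) := by
    refine Integrable.mono' (((exp_neg_integrableOn_Ioi 0 (b := 2) two_pos)).const_mul
      (C ^ 2 * Real.exp (-(x + y)))) ?_ (Eventually.of_forall fun s => ?_)
    · have := continuous_Ai
      exact Continuous.aestronglyMeasurable (by fun_prop)
    · rw [norm_neg, norm_mul, Real.norm_eq_abs, Real.norm_eq_abs]
      calc _ ≤ (C * Real.exp (-(x + s))) * (C * Real.exp (-(y + s))) := by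
            gcongr
            · exact (hb _).1
            · exact (hb _).1
        _ = C ^ 2 * (Real.exp (-(x + s)) * Real.exp (-(y + s))) := by ring
        _ = C ^ 2 * (Real.exp (-(x + y)) * Real.exp (-2 * s)) := by
            rw [← Real.exp_add, ← Real.exp_add]
            congr 2
            ring
        _ = _ := by ring
  have h := integral_Ioi_of_hasDerivAt_of_tendsto' (fun s _ => hasDerivAt_KAiry_diag x y s) hInt
    (tendsto_KAiry_diag x y)
  rw [integral_neg] at h
  simp only [add_zero] at h
  linarith

/-- The probabilists' Hermite polynomials as real functions. -/
noncomputable def herm (n : ℕ) (x : ℝ) : ℝ := Polynomial.aeval x (Polynomial.hermite n)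

lemma derivative_hermite_succ (n : ℕ) :
    Polynomial.derivative (Polynomial.hermite (n + 1)) = (n + 1) * Polynomial.hermite n := by
  induction n with
  | zero => simp
  | succ n ih =>
    rw [Polynomial.hermite_succ (n + 1), Polynomial.derivative_sub, Polynomial.derivative_mul, ih,
      Polynomial.derivative_X]
    have : Polynomial.derivative (((n : Polynomial ℤ) + 1) * Polynomial.hermite n)
        = ((n : Polynomial ℤ) + 1) * Polynomial.derivative (Polynomial.hermite n) := by
      rw [Polynomial.derivative_mul]
      simp
    rw [this, Polynomial.hermite_succ n]
    push_cast
    ring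

lemma herm_zero (x : ℝ) : herm 0 x = 1 := by simp [herm]

lemma herm_one (x : ℝ) : herm 1 x = x := by simp [herm]

lemma herm_succ_succ (n : ℕ) (x : ℝ) :
    herm (n + 2) x = x * herm (n + 1) x - (n + 1) * herm n x := by
  rw [herm, Polynomial.hermite_succ (n + 1), derivative_hermite_succ]
  simp only [herm, map_sub, map_mul, map_add, map_one, map_natCast, Polynomial.aeval_X]

lemma herm_succ (n : ℕ) (x : ℝ) : herm (n + 1) x = x * herm n x - n * herm (n - 1) x := by
  cases n with
  | zero => simp [herm_zero, herm_one]
  | succ n =>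
    rw [herm_succ_succ]
    simp

lemma hasDerivAt_herm (n : ℕ) (x : ℝ) : HasDerivAt (herm n) (n * herm (n - 1) x) x := by
  refine (Polynomial.hasDerivAt_aeval (Polynomial.hermite n) x).congr_deriv ?_
  cases n with
  | zero => simp
  | succ n =>
    rw [derivative_hermite_succ]
    simp only [herm, map_mul, map_add, map_one, map_natCast, Nat.add_sub_cancel, Nat.cast_add,
      Nat.cast_one]

lemma continuous_herm (n : ℕ) : Continuous (herm n) :=
  continuous_iff_continuousAt.2 fun x => (hasDerivAt_herm n x).continuousAt

/-- Unnormalized Hermite functions. -/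
noncomputable def hermFun (n : ℕ) (x : ℝ) : ℝ := herm n x * Real.exp (-(x ^ 2 / 4))

lemma continuous_hermFun (n : ℕ) : Continuous (hermFun n) := by
  have := continuous_herm n
  unfold hermFun
  fun_prop

lemma hasDerivAt_hermFun (n : ℕ) (x : ℝ) :
    HasDerivAt (hermFun n) (n / 2 * hermFun (n - 1) x - hermFun (n + 1) x / 2) x := by
  have h1 : HasDerivAt (fun x : ℝ => -(x ^ 2 / 4)) (-(2 * x / 4)) x := by
    exact (((hasDerivAt_id x).pow 2).div_const 4).neg.congr_deriv (by simp)
  refine ((hasDerivAt_herm n x).mul h1.exp).congr_deriv ?_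
  simp only [hermFun, herm_succ n]
  ring

/-- The Christoffel–Darboux kernel of the Gaussian unitary ensemble. -/
noncomputable def hermKernel (N : ℕ) (x y : ℝ) : ℝ :=
  ∑ k ∈ Finset.range N, hermFun k x * hermFun k y / (k.factorial * √(2 * π))

lemma continuous_hermKernel (N : ℕ) : Continuous fun p : ℝ × ℝ => hermKernel N p.1 p.2 := by
  have := continuous_hermFun
  unfold hermKernel
  fun_prop

lemma hasDerivAt_hermKernel_diag (N : ℕ) (x y s : ℝ) :
    HasDerivAt (fun s => hermKernel (N + 1) (x + s) (y + s))
      (-((hermFun (N + 1) (x + s) * hermFun N (y + s)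
        + hermFun N (x + s) * hermFun (N + 1) (y + s)) / (2 * N.factorial * √(2 * π)))) s := by
  have hpi : √(2 * π) ≠ 0 := by positivity
  have hA : ∀ (k : ℕ) (z : ℝ), HasDerivAt (fun s => hermFun k (z + s))
      (k / 2 * hermFun (k - 1) (z + s) - hermFun (k + 1) (z + s) / 2) s := fun k z =>
    (hasDerivAt_hermFun k (z + s)).comp_const_add z s
  induction N with
  | zero =>
    simp only [hermKernel, zero_add, Finset.sum_range_one]
    refine ((((hA 0 x).mul (hA 0 y))).div_const _).congr_deriv ?_
    simp only [Nat.factorial]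
    push_cast
    field_simp
    ring
  | succ N ih =>
    simp only [hermKernel, Finset.sum_range_succ _ (N + 1)] at ih ⊢
    refine (ih.add (((hA (N + 1) x).mul (hA (N + 1) y)).div_const _)).congr_deriv ?_
    rw [Nat.factorial_succ]
    have : (N.factorial : ℝ) ≠ 0 := by positivity
    push_cast
    field_simp
    ring

lemma tendsto_hermFun_atTop (n : ℕ) : Tendsto (hermFun n) atTop (𝓝 0) := by
  have h := (((Polynomial.hermite n).map (Int.castRingHom ℝ)).tendsto_div_exp_atTop).abs.const_mul
    (Real.exp 1)
  simp only [abs_zero, mul_zero] at h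
  refine squeeze_zero_norm (fun x => ?_) h
  have he : herm n x = Polynomial.eval x ((Polynomial.hermite n).map (Int.castRingHom ℝ)) := by
    rw [herm, Polynomial.eval_map, Polynomial.aeval_def]
    rfl
  rw [hermFun, norm_mul, Real.norm_eq_abs, Real.norm_eq_abs, Real.abs_exp, ← he, abs_div,
    Real.abs_exp]
  calc |herm n x| * Real.exp (-(x ^ 2 / 4)) ≤ |herm n x| * Real.exp (1 - x) := by
        gcongr
        nlinarith [sq_nonneg (x - 2)]
    _ = _ := by
        rw [Real.exp_sub]
        ring

lemma tendsto_hermKernel_diag (N : ℕ) (x y : ℝ) :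
    Tendsto (fun s => hermKernel N (x + s) (y + s)) atTop (𝓝 0) := by
  have h : ∀ (k : ℕ) (z : ℝ), Tendsto (fun s => hermFun k (z + s)) atTop (𝓝 0) := fun k z =>
    (tendsto_hermFun_atTop k).comp (tendsto_atTop_add_const_left atTop z tendsto_id)
  unfold hermKernel
  rw [← Finset.sum_const_zero (s := Finset.range N)]
  refine tendsto_finsetSum _ fun k _ => ?_
  simpa using ((h k x).mul (h k y)).div_const (k.factorial * √(2 * π))

lemma integrable_polynomial_mul_gaussian (p : Polynomial ℝ) :
    Integrable fun x : ℝ => p.eval x * Real.exp (-(x ^ 2 / 2)) := by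
  induction p using Polynomial.induction_on' with
  | add p q hp hq =>
    simp only [Polynomial.eval_add, add_mul]
    exact hp.add hq
  | monomial k a =>
    have h := (integrable_rpow_mul_exp_neg_mul_sq (b := 1 / 2) (by norm_num)
      (s := k) (by have : (0:ℝ) ≤ k := k.cast_nonneg
                   linarith)).const_mul a
    refine h.congr (Eventually.of_forall fun x => ?_)
    simp only [Polynomial.eval_monomial, Real.rpow_natCast]
    rw [mul_assoc]
    congr 3
    ring

lemma herm_eq_eval (n : ℕ) (x : ℝ) :
    herm n x = ((Polynomial.hermite n).map (Int.castRingHom ℝ)).eval x := by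
  rw [herm, Polynomial.eval_map, Polynomial.aeval_def]
  rfl

lemma integrable_herm_mul_herm (m n : ℕ) :
    Integrable fun x : ℝ => herm m x * herm n x * Real.exp (-(x ^ 2 / 2)) := by
  simpa only [herm_eq_eval, Polynomial.eval_mul] using integrable_polynomial_mul_gaussian
    (((Polynomial.hermite m).map (Int.castRingHom ℝ)) *
      ((Polynomial.hermite n).map (Int.castRingHom ℝ)))

lemma integral_herm_succ_mul (m n : ℕ) :
    ∫ x : ℝ, herm (m + 1) x * herm n x * Real.exp (-(x ^ 2 / 2))
      = n * ∫ x : ℝ, herm m x * herm (n - 1) x * Real.exp (-(x ^ 2 / 2)) := by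
  have hd : ∀ x : ℝ, HasDerivAt (fun x => herm m x * herm n x * Real.exp (-(x ^ 2 / 2)))
      (n * (herm m x * herm (n - 1) x * Real.exp (-(x ^ 2 / 2)))
        - herm (m + 1) x * herm n x * Real.exp (-(x ^ 2 / 2))) x := by
    intro x
    have h1 : HasDerivAt (fun x : ℝ => -(x ^ 2 / 2)) (-(2 * x / 2)) x := by
      exact (((hasDerivAt_id x).pow 2).div_const 2).neg.congr_deriv (by simp)
    refine (((hasDerivAt_herm m x).mul (hasDerivAt_herm n x)).mul h1.exp).congr_deriv ?_
    rw [herm_succ m, Pi.mul_apply]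
    ring
  have i1 := (integrable_herm_mul_herm m (n - 1)).const_mul (n : ℝ)
  have i2 := integrable_herm_mul_herm (m + 1) n
  have h := integral_eq_zero_of_hasDerivAt_of_integrable hd (i1.sub i2)
    (integrable_herm_mul_herm m n)
  rw [integral_sub i1 i2, integral_const_mul] at h
  linarith

lemma integral_herm_mul_herm (m n : ℕ) :
    ∫ x : ℝ, herm m x * herm n x * Real.exp (-(x ^ 2 / 2))
      = if m = n then m.factorial * √(2 * π) else 0 := by
  induction m generalizing n with
  | zero =>
    cases n with
    | zero =>
      simp only [herm_zero, one_mul, if_true, Nat.factorial_zero, Nat.cast_one]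
      have := integral_gaussian (1 / 2)
      rw [show π / (1 / 2) = 2 * π by ring] at this
      rw [← this]
      congr 1
      ext x
      ring_nf
    | succ n =>
      have := integral_herm_succ_mul n 0
      simp only [Nat.cast_zero, zero_mul] at this
      simp only [mul_comm (herm 0 _)]
      simpa using this
  | succ m ih =>
    rw [integral_herm_succ_mul]
    cases n with
    | zero => simp
    | succ n =>
      simp only [Nat.add_sub_cancel, ih, Nat.add_right_cancel_iff]
      split_ifs with h
      · subst h
        rw [Nat.factorial_succ]
        push_cast
        ring
      · simp

lemma hermFun_mul_hermFun (m n : ℕ) (x : ℝ) :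
    hermFun m x * hermFun n x = herm m x * herm n x * Real.exp (-(x ^ 2 / 2)) := by
  rw [hermFun, hermFun, mul_mul_mul_comm, ← Real.exp_add]
  ring_nf

lemma integrable_hermFun_mul_hermFun (m n : ℕ) :
    Integrable fun x : ℝ => hermFun m x * hermFun n x := by
  simpa only [hermFun_mul_hermFun] using integrable_herm_mul_herm m n

lemma integral_hermFun_mul_hermFun (m n : ℕ) :
    ∫ x : ℝ, hermFun m x * hermFun n x = if m = n then m.factorial * √(2 * π) else 0 := by
  simp only [hermFun_mul_hermFun, integral_herm_mul_herm]

/-- The Fourier coefficients of the Hermite generating function on a circle. -/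
noncomputable def hermCircle (R x : ℝ) (n : ℕ) : ℂ :=
  ∫ θ in (-π)..π, Complex.exp (x * circleMap 0 R θ - circleMap 0 R θ ^ 2 / 2)
    * (circleMap 0 R θ)⁻¹ ^ n

lemma intervalIntegral_circleMap_eq {f : ℂ → ℂ} (hf : Differentiable ℂ f) (R : ℝ) :
    ∫ θ in (-π)..π, f (circleMap 0 R θ) = 2 * π * f 0 := by
  have hp : Function.Periodic (fun θ => f (circleMap 0 R θ)) (2 * π) := fun θ => by
    simp only [periodic_circleMap 0 R θ]
  have h := hp.intervalIntegral_add_eq (-π) 0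
  have e1 : -π + 2 * π = π := by ring
  rw [e1, zero_add] at h
  have h2 := (hf.diffContOnCl (s := Metric.ball 0 |R|)).circleAverage
  rw [Real.circleAverage, Complex.real_smul] at h2
  rw [h, ← h2]
  push_cast
  have : (π : ℂ) ≠ 0 := by exact_mod_cast Real.pi_ne_zero
  field_simp

lemma continuous_hermCircle_integrand {R : ℝ} (hR : R ≠ 0) (x : ℝ) (n : ℕ) :
    Continuous fun θ : ℝ => Complex.exp (x * circleMap 0 R θ - circleMap 0 R θ ^ 2 / 2)
      * (circleMap 0 R θ)⁻¹ ^ n := by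
  have h := continuous_circleMap 0 R
  have h' : Continuous fun θ : ℝ => (circleMap 0 R θ)⁻¹ :=
    h.inv₀ fun θ => circleMap_ne_center hR
  fun_prop

lemma hermCircle_zero (R x : ℝ) : hermCircle R x 0 = 2 * π := by
  have := intervalIntegral_circleMap_eq
    (f := fun z : ℂ => Complex.exp (x * z - z ^ 2 / 2)) (by fun_prop) R
  simpa [hermCircle] using this

/-- Integrating the derivative of a periodic function over a period. -/
lemma integral_circle_relation {R : ℝ} (hR : R ≠ 0) (x : ℝ) (n : ℕ) :
    ∫ θ in (-π)..π, (x * circleMap 0 R θ - circleMap 0 R θ ^ 2 - n) *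
      (Complex.exp (x * circleMap 0 R θ - circleMap 0 R θ ^ 2 / 2)
        * (circleMap 0 R θ)⁻¹ ^ n) = 0 := by
  have hz : ∀ θ, circleMap 0 R θ ≠ 0 := fun θ => circleMap_ne_center hR
  have hd : ∀ θ : ℝ, HasDerivAt (fun θ : ℝ =>
      Complex.exp (x * circleMap 0 R θ - circleMap 0 R θ ^ 2 / 2) * (circleMap 0 R θ)⁻¹ ^ n)
      (Complex.I * ((x * circleMap 0 R θ - circleMap 0 R θ ^ 2 - n) *
      (Complex.exp (x * circleMap 0 R θ - circleMap 0 R θ ^ 2 / 2)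
        * (circleMap 0 R θ)⁻¹ ^ n))) θ := by
    intro θ
    have h0 := hasDerivAt_circleMap 0 R θ
    have h1 : HasDerivAt (fun θ : ℝ => x * circleMap 0 R θ - circleMap 0 R θ ^ 2 / 2) _ θ :=
      (h0.const_mul (x : ℂ)).sub ((h0.pow 2).div_const 2)
    have h2 : HasDerivAt (fun θ : ℝ => (circleMap 0 R θ)⁻¹ ^ n) _ θ := (h0.fun_inv (hz θ)).pow n
    refine (h1.cexp.mul h2).congr_deriv ?_
    have hdiv : -(circleMap 0 R θ * Complex.I) / circleMap 0 R θ ^ 2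
        = -Complex.I * (circleMap 0 R θ)⁻¹ := by
      have := hz θ
      field_simp
    rw [hdiv]
    cases n with
    | zero =>
      push_cast
      simp
      ring
    | succ n =>
      push_cast
      ring
  have hcont : Continuous fun θ : ℝ => Complex.I *
      ((x * circleMap 0 R θ - circleMap 0 R θ ^ 2 - n) *
      (Complex.exp (x * circleMap 0 R θ - circleMap 0 R θ ^ 2 / 2)
        * (circleMap 0 R θ)⁻¹ ^ n)) := by
    have := continuous_hermCircle_integrand hR x n
    have h := continuous_circleMap 0 R
    fun_prop
  have h := intervalIntegral.integral_eq_sub_of_hasDerivAt (a := -π) (b := π)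
    (fun θ _ => hd θ) (hcont.intervalIntegrable _ _)
  have hper : circleMap 0 R π = circleMap 0 R (-π) := by
    have := periodic_circleMap 0 R (-π)
    rw [← this]
    congr 1
    ring
  rw [hper, sub_self, intervalIntegral.integral_const_mul] at h
  exact (mul_eq_zero.1 h).resolve_left Complex.I_ne_zero

lemma hermCircle_one {R : ℝ} (hR : R ≠ 0) (x : ℝ) : hermCircle R x 1 = 2 * π * x := by
  have h := integral_circle_relation hR x 1
  have hz : ∀ θ, circleMap 0 R θ ≠ 0 := fun θ => circleMap_ne_center hR
  have c1 := continuous_hermCircle_integrand hR x 1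
  have c0 := continuous_hermCircle_integrand hR x 0
  have hE : ∀ θ, (x * circleMap 0 R θ - circleMap 0 R θ ^ 2 - (1 : ℕ)) *
      (Complex.exp (x * circleMap 0 R θ - circleMap 0 R θ ^ 2 / 2) * (circleMap 0 R θ)⁻¹ ^ 1)
      = ((x - circleMap 0 R θ) *
        Complex.exp (x * circleMap 0 R θ - circleMap 0 R θ ^ 2 / 2)) -
        Complex.exp (x * circleMap 0 R θ - circleMap 0 R θ ^ 2 / 2) * (circleMap 0 R θ)⁻¹ ^ 1 := by
    intro θ
    have := hz θ
    push_cast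
    field_simp
  simp_rw [hE] at h
  have cm := continuous_circleMap 0 R
  have h2 := intervalIntegral_circleMap_eq
    (f := fun z : ℂ => (x - z) * Complex.exp (x * z - z ^ 2 / 2)) (by fun_prop) R
  rw [intervalIntegral.integral_sub (Continuous.intervalIntegrable (by fun_prop) _ _)
    (c1.intervalIntegrable _ _), h2] at h
  rw [hermCircle, ← sub_eq_zero.1 h]
  simp

lemma hermCircle_succ_succ {R : ℝ} (hR : R ≠ 0) (x : ℝ) (n : ℕ) :
    (n + 2) * hermCircle R x (n + 2) = x * hermCircle R x (n + 1) - hermCircle R x n := by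
  have h := integral_circle_relation hR x (n + 2)
  have hz : ∀ θ, circleMap 0 R θ ≠ 0 := fun θ => circleMap_ne_center hR
  have c2 := continuous_hermCircle_integrand hR x (n + 2)
  have c1 := continuous_hermCircle_integrand hR x (n + 1)
  have c0 := continuous_hermCircle_integrand hR x n
  have hE : ∀ θ, (x * circleMap 0 R θ - circleMap 0 R θ ^ 2 - (n + 2 : ℕ)) *
      (Complex.exp (x * circleMap 0 R θ - circleMap 0 R θ ^ 2 / 2)
        * (circleMap 0 R θ)⁻¹ ^ (n + 2))
      = x * (Complex.exp (x * circleMap 0 R θ - circleMap 0 R θ ^ 2 / 2)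
        * (circleMap 0 R θ)⁻¹ ^ (n + 1)) -
        (Complex.exp (x * circleMap 0 R θ - circleMap 0 R θ ^ 2 / 2)
        * (circleMap 0 R θ)⁻¹ ^ n) - (n + 2) *
        (Complex.exp (x * circleMap 0 R θ - circleMap 0 R θ ^ 2 / 2)
        * (circleMap 0 R θ)⁻¹ ^ (n + 2)) := by
    intro θ
    have hi := mul_inv_cancel₀ (hz θ)
    push_cast
    linear_combination Complex.exp (x * circleMap 0 R θ - circleMap 0 R θ ^ 2 / 2)
      * (circleMap 0 R θ)⁻¹ ^ n * (x * (circleMap 0 R θ)⁻¹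
        - circleMap 0 R θ * (circleMap 0 R θ)⁻¹ - 1) * hi
  simp_rw [hE] at h
  rw [intervalIntegral.integral_sub (Continuous.intervalIntegrable (by fun_prop) _ _)
    (Continuous.intervalIntegrable (by fun_prop) _ _),
    intervalIntegral.integral_sub (Continuous.intervalIntegrable (by fun_prop) _ _)
    (Continuous.intervalIntegrable (by fun_prop) _ _), intervalIntegral.integral_const_mul,
    intervalIntegral.integral_const_mul] at h
  exact (sub_eq_zero.1 h).symm

lemma herm_eq_hermCircle {R : ℝ} (hR : R ≠ 0) (x : ℝ) (n : ℕ) :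
    (herm n x : ℂ) = n.factorial / (2 * π) * hermCircle R x n := by
  have hpi : (π : ℂ) ≠ 0 := by exact_mod_cast Real.pi_ne_zero
  induction n using Nat.twoStepInduction with
  | zero =>
    rw [hermCircle_zero, herm_zero]
    field_simp
    simp
  | one =>
    rw [hermCircle_one hR, herm_one]
    field_simp
    simp
  | more n h0 h1 =>
    rw [herm_succ_succ]
    push_cast
    rw [h0, h1, Nat.factorial_succ (n + 1), Nat.factorial_succ n]
    have h := hermCircle_succ_succ hR x n
    push_cast
    field_simp
    linear_combination (-(n.factorial : ℂ)) * h

/-- The phase function of the Hermite contour integral at the double saddle point. -/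
noncomputable def edgePhase (w : ℂ) : ℂ :=
  2 * Complex.exp w - Complex.exp (2 * w) / 2 - w - 3 / 2

/-- The rescaled Hermite contour integrand at the spectral edge, with `q = N ^ (1 / 6)`. -/
noncomputable def edgeIntegrand (j : ℕ) (q ξ u : ℝ) : ℂ :=
  Complex.exp (q ^ 6 * edgePhase ((-1 + u * Complex.I) / q ^ 2)
    + ξ * (q ^ 2 * (Complex.exp ((-1 + u * Complex.I) / q ^ 2) - 1))
    - ξ ^ 2 / (4 * q ^ 2) + j * ((-1 + u * Complex.I) / q ^ 2))

/-- The rescaled Hermite function at the spectral edge. -/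
noncomputable def edgeFun (j : ℕ) (q ξ : ℝ) : ℂ :=
  1 / (2 * π) * ∫ u in (-(π * q ^ 2))..(π * q ^ 2), edgeIntegrand j q ξ u

lemma hermFun_eq_edgeFun {N j : ℕ} {q : ℝ} (hq : 0 < q) (hN : (N : ℝ) = q ^ 6) (hj : j ≤ N)
    (ξ : ℝ) :
    (hermFun (N - j) (2 * q ^ 3 + ξ / q) : ℂ) =
      (N - j).factorial * ((q : ℂ) ^ 3)⁻¹ ^ (N - j) * ((q : ℂ) ^ 2)⁻¹ * Complex.exp (q ^ 6 / 2)
        * edgeFun j q ξ := by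
  have hqc : (q : ℂ) ≠ 0 := by exact_mod_cast hq.ne'
  have hR : q ^ 3 * Real.exp (-1 / q ^ 2) ≠ 0 := by positivity
  have hNc : (N : ℂ) = (q : ℂ) ^ 6 := by exact_mod_cast hN
  have hsub := intervalIntegral.integral_comp_div (a := -(π * q ^ 2)) (b := π * q ^ 2)
    (fun θ : ℝ => Complex.exp ((2 * q ^ 3 + ξ / q : ℝ) *
      circleMap 0 (q ^ 3 * Real.exp (-1 / q ^ 2)) θ
        - circleMap 0 (q ^ 3 * Real.exp (-1 / q ^ 2)) θ ^ 2 / 2)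
      * (circleMap 0 (q ^ 3 * Real.exp (-1 / q ^ 2)) θ)⁻¹ ^ (N - j)) (c := q ^ 2) (by positivity)
  have e1 : -(π * q ^ 2) / q ^ 2 = -π := by field_simp
  have e2 : π * q ^ 2 / q ^ 2 = π := by field_simp
  rw [e1, e2] at hsub
  have hpt : ∀ u : ℝ, Complex.exp ((2 * q ^ 3 + ξ / q : ℝ) *
      circleMap 0 (q ^ 3 * Real.exp (-1 / q ^ 2)) (u / q ^ 2)
        - circleMap 0 (q ^ 3 * Real.exp (-1 / q ^ 2)) (u / q ^ 2) ^ 2 / 2)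
      * (circleMap 0 (q ^ 3 * Real.exp (-1 / q ^ 2)) (u / q ^ 2))⁻¹ ^ (N - j)
      = (((q : ℂ) ^ 3)⁻¹ ^ (N - j) * Complex.exp (q ^ 6 / 2)
        * Complex.exp ((2 * q ^ 3 + ξ / q : ℝ) ^ 2 / 4)) * edgeIntegrand j q ξ u := by
    intro u
    have hc : circleMap 0 (q ^ 3 * Real.exp (-1 / q ^ 2)) (u / q ^ 2)
        = q ^ 3 * Complex.exp ((-1 + u * Complex.I) / q ^ 2) := by
      rw [circleMap, zero_add]
      push_cast
      rw [mul_assoc, ← Complex.exp_add]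
      congr 2
      ring
    have hinv : ((q : ℂ) ^ 3 * Complex.exp ((-1 + u * Complex.I) / q ^ 2))⁻¹ ^ (N - j)
        = ((q : ℂ) ^ 3)⁻¹ ^ (N - j)
          * Complex.exp (((q : ℂ) ^ 6 - j) * -((-1 + u * Complex.I) / q ^ 2)) := by
      rw [mul_inv, mul_pow, ← Complex.exp_neg, ← Complex.exp_nat_mul, Nat.cast_sub hj, hNc]
    rw [hc, hinv, edgeIntegrand, edgePhase]
    rw [mul_left_comm, mul_assoc, mul_assoc, ← Complex.exp_add, ← Complex.exp_add,
      ← Complex.exp_add]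
    congr 2
    have : Complex.exp (2 * ((-1 + u * Complex.I) / q ^ 2))
        = Complex.exp ((-1 + u * Complex.I) / q ^ 2) ^ 2 := by
      rw [← Complex.exp_nat_mul]
      norm_num
    rw [this]
    push_cast
    field_simp
    ring
  simp_rw [hpt] at hsub
  rw [intervalIntegral.integral_const_mul] at hsub
  rw [hermFun]
  push_cast
  rw [herm_eq_hermCircle hR, hermCircle, edgeFun]
  rw [Complex.real_smul] at hsub
  push_cast at hsub ⊢
  have hq2 : (q : ℂ) ^ 2 ≠ 0 := pow_ne_zero _ hqc
  have hpi : (π : ℂ) ≠ 0 := by exact_mod_cast Real.pi_ne_zero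
  rw [← (inv_mul_eq_iff_eq_mul₀ hq2).2 hsub, Complex.exp_neg]
  have := Complex.exp_ne_zero ((2 * (q : ℂ) ^ 3 + ξ / q) ^ 2 / 4)
  field_simp

lemma edgePhase_isLittleO :
    (fun w : ℂ => edgePhase w + w ^ 3 / 3) =o[𝓝 0] fun w : ℂ => w ^ 3 := by
  have h1 := Complex.exp_sub_sum_range_succ_isLittleO_pow 3
  have h2 : (fun w : ℂ => Complex.exp (2 * w) - ∑ i ∈ Finset.range 4,
      (2 * w) ^ i / (i.factorial : ℂ)) =o[𝓝 0] fun w : ℂ => w ^ 3 := by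
    have ht : Tendsto (fun w : ℂ => 2 * w) (𝓝 0) (𝓝 0) := by
      have : Continuous fun w : ℂ => 2 * w := by fun_prop
      simpa using this.tendsto 0
    have := h1.comp_tendsto ht
    refine this.trans_isBigO ?_
    simp only [Function.comp_def, mul_pow]
    exact Asymptotics.isBigO_const_mul_self _ _ _
  refine ((h1.const_mul_left 2).sub (h2.const_mul_left (1 / 2))).congr_left fun w => ?_
  simp only [edgePhase, Finset.sum_range_succ, Finset.sum_range_zero, Nat.factorial]
  push_cast
  ring

lemma tendsto_edgePhase {a : ℂ} (ha : a ≠ 0) :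
    Tendsto (fun q : ℝ => (q : ℂ) ^ 6 * edgePhase (a / q ^ 2)) atTop (𝓝 (-a ^ 3 / 3)) := by
  have hw : Tendsto (fun q : ℝ => a / (q : ℂ) ^ 2) atTop (𝓝 0) := by
    have h : Tendsto (fun q : ℝ => ((q ^ 2)⁻¹ : ℝ)) atTop (𝓝 0) :=
      tendsto_inv_atTop_zero.comp (tendsto_pow_atTop two_ne_zero)
    have := ((Complex.continuous_ofReal.tendsto _).comp h).const_mul a
    simpa [div_eq_mul_inv, Function.comp_def] using this
  have h := (edgePhase_isLittleO.tendsto_div_nhds_zero.comp hw).const_mul (a ^ 3)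
  rw [mul_zero] at h
  have h' := h.add_const (-a ^ 3 / 3)
  rw [zero_add] at h'
  refine h'.congr' ?_
  filter_upwards [eventually_gt_atTop 0] with q hq
  have hqc : (q : ℂ) ≠ 0 := by exact_mod_cast hq.ne'
  simp only [Function.comp]
  generalize edgePhase (a / q ^ 2) = E
  field_simp
  ring

lemma tendsto_mul_exp_sub_one (a : ℂ) :
    Tendsto (fun q : ℝ => (q : ℂ) ^ 2 * (Complex.exp (a / q ^ 2) - 1)) atTop (𝓝 a) := by
  have h1 : HasDerivAt (fun t : ℝ => Complex.exp (a * t)) a 0 := by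
    have h0 : HasDerivAt (fun t : ℝ => a * (t : ℂ)) (a * 1) 0 :=
      (Complex.ofRealCLM.hasDerivAt (x := (0 : ℝ))).const_mul a
    simpa using h0.cexp
  have h2 := h1.tendsto_slope_zero_right
  have h : Tendsto (fun q : ℝ => ((q ^ 2)⁻¹ : ℝ)) atTop (𝓝[>] 0) :=
    tendsto_inv_atTop_nhdsGT_zero.comp (tendsto_pow_atTop two_ne_zero)
  refine (h2.comp h).congr fun q => ?_
  simp [div_eq_mul_inv]

lemma neg_one_add_mul_I_ne_zero (u : ℝ) : (-1 + u * Complex.I : ℂ) ≠ 0 := by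
  intro h
  have := congrArg Complex.re h
  simp at this

lemma tendsto_edgeIntegrand (j : ℕ) (ξ u : ℝ) :
    Tendsto (fun q : ℝ => edgeIntegrand j q ξ u) atTop (𝓝 (airyIntegrand ξ (-u))) := by
  unfold edgeIntegrand airyIntegrand
  refine (Complex.continuous_exp.tendsto _).comp ?_
  have h1 := tendsto_edgePhase (neg_one_add_mul_I_ne_zero u)
  have h2 := (tendsto_mul_exp_sub_one (-1 + u * Complex.I)).const_mul (ξ : ℂ)
  have h0 : Tendsto (fun q : ℝ => ((q ^ 2)⁻¹ : ℝ)) atTop (𝓝 0) :=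
      tendsto_inv_atTop_zero.comp (tendsto_pow_atTop two_ne_zero)
  have h0' := (Complex.continuous_ofReal.tendsto _).comp h0
  have h3 := h0'.const_mul ((ξ : ℂ) ^ 2 / 4)
  have h4 := h0'.const_mul ((j : ℂ) * (-1 + u * Complex.I))
  have := ((h1.add h2).sub h3).add h4
  convert this using 1
  · ext q
    simp only [Function.comp]
    push_cast
    rw [div_mul_eq_div_div]
    ring_nf
  · congr 1
    push_cast
    ring

lemma edgeIntegrand_re (j : ℕ) (q ξ u : ℝ) :
    (q ^ 6 * edgePhase ((-1 + u * Complex.I) / q ^ 2)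
      + ξ * (q ^ 2 * (Complex.exp ((-1 + u * Complex.I) / q ^ 2) - 1))
      - ξ ^ 2 / (4 * q ^ 2) + j * ((-1 + u * Complex.I) / q ^ 2)).re =
    q ^ 6 * (2 * (rexp (-1 / q ^ 2) * cos (u / q ^ 2))
      - rexp (-1 / q ^ 2) ^ 2 * (2 * cos (u / q ^ 2) ^ 2 - 1) / 2 - -1 / q ^ 2 - 3 / 2)
      + ξ * (q ^ 2 * (rexp (-1 / q ^ 2) * cos (u / q ^ 2) - 1)) - ξ ^ 2 / (4 * q ^ 2)
      + j * (-1 / q ^ 2) := by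
  have hw : ((-1 + u * Complex.I) / (q : ℂ) ^ 2) = ⟨-1 / q ^ 2, u / q ^ 2⟩ := by
    rw [Complex.mk_eq_add_mul_I]
    push_cast
    ring
  have h2 : (2 : ℂ) * ⟨-1 / q ^ 2, u / q ^ 2⟩ = ⟨2 * (-1 / q ^ 2), 2 * (u / q ^ 2)⟩ := by
    apply Complex.ext <;> simp
  have e6 : (q : ℂ) ^ 6 = ((q ^ 6 : ℝ) : ℂ) := by push_cast; rfl
  have e2 : (q : ℂ) ^ 2 = ((q ^ 2 : ℝ) : ℂ) := by push_cast; rfl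
  have e3 : (ξ : ℂ) ^ 2 / (4 * ((q ^ 2 : ℝ) : ℂ)) = ((ξ ^ 2 / (4 * q ^ 2) : ℝ) : ℂ) := by
    push_cast; rfl
  have ej : (j : ℂ) = ((j : ℝ) : ℂ) := by push_cast; rfl
  have e32 : (3 / 2 : ℂ) = ((3 / 2 : ℝ) : ℂ) := by push_cast; rfl
  have et : (2 : ℂ) = ((2 : ℝ) : ℂ) := by push_cast; rfl
  have hr : rexp (2 * (-1 / q ^ 2)) = rexp (-1 / q ^ 2) ^ 2 := by
    rw [← Real.exp_nat_mul]; norm_num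
  rw [edgePhase, hw, h2, e6, e2, e3, ej, e32]
  simp only [Complex.add_re, Complex.sub_re, Complex.re_ofReal_mul, Complex.ofReal_re,
    Complex.one_re, Complex.exp_re, Complex.div_ofNat_re]
  rw [et, Complex.re_ofReal_mul, Complex.exp_re, hr, Real.cos_two_mul]

lemma exists_edgePhase_le_one :
    ∃ q₀ : ℝ, ∀ q ≥ q₀, q ^ 6 * (2 * rexp (-1 / q ^ 2) - rexp (-1 / q ^ 2) ^ 2 / 2
      - -1 / q ^ 2 - 3 / 2) ≤ 1 := by
  have h := (Complex.continuous_re.tendsto _).comp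
    (tendsto_edgePhase (a := -1) (by norm_num))
  have h1 : (-(-1 : ℂ) ^ 3 / 3).re < 1 := by norm_num
  obtain ⟨q₀, hq₀⟩ := eventually_atTop.1 (h.eventually_le_const h1)
  refine ⟨q₀, fun q hq => (le_of_eq ?_).trans (hq₀ q hq)⟩
  have := edgeIntegrand_re 0 q 0 0
  simp only [Function.comp]
  simp only [Complex.ofReal_zero, zero_mul, add_zero, CharP.cast_eq_zero, zero_div, cos_zero,
    mul_one, ne_eq, OfNat.ofNat_ne_zero, not_false_eq_true, zero_pow, sub_zero, one_pow] at this
  rw [this]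
  ring

lemma edge_exponent_le {L q ξ r c a : ℝ} (hL : 0 ≤ L) (hξ : -L ≤ ξ) (hqL : 2 * L ≤ q ^ 2)
    (hq : 1 ≤ q ^ 2) (hr0 : 1 / 3 ≤ r) (hr1 : 1 / (2 * q ^ 2) ≤ 1 - r) (hr2 : 1 - r ≤ 1 / q ^ 2)
    (hc0 : c ≤ 1)
    (h : q ^ 6 * (2 * r - r ^ 2 / 2 - a - 3 / 2) ≤ 1) :
    q ^ 6 * (2 * (r * c) - r ^ 2 * (2 * c ^ 2 - 1) / 2 - a - 3 / 2)
      + ξ * (q ^ 2 * (r * c - 1)) ≤ 1 + L - ξ / 2 - q ^ 4 / 6 * (1 - c) := by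
  set Q := q ^ 2 with hQ
  have e6 : q ^ 6 = Q ^ 3 := by rw [hQ]; ring
  have e4 : q ^ 4 = Q ^ 2 := by rw [hQ]; ring
  rw [e6] at h ⊢
  rw [e4]
  have hQ0 : 0 < Q := by linarith
  have k1 : 1 / 2 ≤ Q * (1 - r) := by
    have := mul_le_mul_of_nonneg_left hr1 hQ0.le
    rwa [show Q * (1 / (2 * Q)) = 1 / 2 by field_simp] at this
  have k2 : Q * (1 - r) ≤ 1 := by
    have := mul_le_mul_of_nonneg_left hr2 hQ0.le
    rwa [show Q * (1 / Q) = 1 by field_simp] at this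
  have hid : Q ^ 3 * (2 * (r * c) - r ^ 2 * (2 * c ^ 2 - 1) / 2 - a - 3 / 2)
      + ξ * (Q * (r * c - 1)) = Q ^ 3 * (2 * r - r ^ 2 / 2 - a - 3 / 2)
      - r * (1 - c) * (2 * Q ^ 2 * (Q * (1 - r)) + ξ * Q) - Q ^ 3 * r ^ 2 * (1 - c) ^ 2
      - ξ * (Q * (1 - r)) := by ring
  have k3 : Q ^ 2 / 2 ≤ 2 * Q ^ 2 * (Q * (1 - r)) + ξ * Q := by nlinarith [sq_nonneg Q]
  have k4 : Q ^ 2 / 6 * (1 - c) ≤ r * (1 - c) * (2 * Q ^ 2 * (Q * (1 - r)) + ξ * Q) := by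
    have : 1 / 3 * (Q ^ 2 / 2) ≤ r * (2 * Q ^ 2 * (Q * (1 - r)) + ξ * Q) :=
      mul_le_mul hr0 k3 (by positivity) (by linarith)
    nlinarith
  have k5 : 0 ≤ Q ^ 3 * r ^ 2 * (1 - c) ^ 2 := by positivity
  have k6 : -(ξ * (Q * (1 - r))) ≤ L - ξ / 2 := by
    rcases le_total 0 ξ with h0 | h0 <;> nlinarith
  rw [hid]
  linarith

lemma exists_norm_edgeIntegrand_le {L : ℝ} (hL : 0 ≤ L) :
    ∃ q₀ : ℝ, 1 ≤ q₀ ∧ ∀ (j : ℕ), ∀ q ≥ q₀, ∀ ξ ≥ -L, ∀ u : ℝ, |u| ≤ π * q ^ 2 →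
      ‖edgeIntegrand j q ξ u‖ ≤ rexp (1 + L) * rexp (-(ξ / 2)) * rexp (-(1 / (3 * π ^ 2)) * u ^ 2) := by
  obtain ⟨q₁, hq₁⟩ := exists_edgePhase_le_one
  refine ⟨max q₁ (max 1 (2 * L)), by simp, fun j q hq ξ hξ u hu => ?_⟩
  simp only [ge_iff_le, max_le_iff] at hq
  obtain ⟨hqq, hq1, hqL⟩ := hq
  have hQ : 1 ≤ q ^ 2 := by nlinarith
  have hQ0 : 0 < q ^ 2 := by linarith
  have hinv : 1 / q ^ 2 ≤ 1 := by rw [div_le_one hQ0]; exact hQ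
  have hinv0 : 0 < 1 / q ^ 2 := by positivity
  rw [edgeIntegrand, Complex.norm_exp, edgeIntegrand_re, ← Real.exp_add, ← Real.exp_add,
    Real.exp_le_exp]
  have hc := Real.cos_le_one_sub_mul_cos_sq (x := u / q ^ 2) (by
    rw [abs_div, abs_of_pos hQ0, div_le_iff₀ hQ0]; exact hu)
  have hr2 := Real.add_one_le_exp (-1 / q ^ 2)
  have hneg : -1 / q ^ 2 = -(1 / q ^ 2) := by ring
  have hr1 : 1 / (2 * q ^ 2) ≤ 1 - rexp (-1 / q ^ 2) := by
    have : rexp (-1 / q ^ 2) ≤ 1 / (1 + 1 / q ^ 2) := by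
      rw [hneg, Real.exp_neg, ← one_div]
      apply one_div_le_one_div_of_le (by positivity)
      have := Real.add_one_le_exp (1 / q ^ 2)
      linarith
    have h2 : 1 / (1 + 1 / q ^ 2) ≤ 1 - 1 / (2 * q ^ 2) := by
      rw [div_le_iff₀ (by positivity)]
      have : 1 / (2 * q ^ 2) = (1 / q ^ 2) / 2 := by field_simp
      rw [this]
      nlinarith
    linarith
  have hr0 : 1 / 3 ≤ rexp (-1 / q ^ 2) := by
    have h1 : rexp (-1) ≤ rexp (-1 / q ^ 2) := by
      rw [Real.exp_le_exp, hneg]; linarith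
    have h2 : (1 : ℝ) / 3 ≤ rexp (-1) := by
      rw [Real.exp_neg, ← one_div]
      exact one_div_le_one_div_of_le (by positivity) (by linarith [Real.exp_one_lt_d9])
    linarith
  have key := edge_exponent_le hL hξ (by nlinarith) hQ hr0 hr1 (by rw [hneg] at hr2; rw [hneg]; linarith)
    (Real.cos_le_one (u / q ^ 2)) (hq₁ q hqq)
  have h3 : 0 ≤ ξ ^ 2 / (4 * q ^ 2) := by positivity
  have h4 : (j : ℝ) * (-1 / q ^ 2) ≤ 0 := by
    rw [hneg]
    have : 0 ≤ (j : ℝ) * (1 / q ^ 2) := by positivity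
    linarith
  have h5 : 1 / (3 * π ^ 2) * u ^ 2 ≤ q ^ 4 / 6 * (1 - cos (u / q ^ 2)) := by
    have : q ^ 4 / 6 * (2 / π ^ 2 * (u / q ^ 2) ^ 2) ≤ q ^ 4 / 6 * (1 - cos (u / q ^ 2)) := by
      gcongr
      linarith
    refine le_trans (le_of_eq ?_) this
    have : q ≠ 0 := by positivity
    field_simp
    ring
  linarith

lemma exists_norm_edgeFun_le {L : ℝ} (hL : 0 ≤ L) :
    ∃ q₀ C : ℝ, 1 ≤ q₀ ∧ 0 ≤ C ∧ ∀ (j : ℕ), ∀ q ≥ q₀, ∀ ξ ≥ -L,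
      ‖edgeFun j q ξ‖ ≤ C * rexp (-(ξ / 2)) := by
  obtain ⟨q₀, h1, h⟩ := exists_norm_edgeIntegrand_le hL
  have hb : 0 < 1 / (3 * π ^ 2) := by positivity
  refine ⟨q₀, 1 / (2 * π) * (rexp (1 + L) * ∫ u : ℝ, rexp (-(1 / (3 * π ^ 2)) * u ^ 2)), h1,
    by positivity, fun j q hq ξ hξ => ?_⟩
  have hq0 : 0 ≤ π * q ^ 2 := by positivity
  have hle : -(π * q ^ 2) ≤ π * q ^ 2 := by linarith
  rw [edgeFun, norm_mul, mul_assoc]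
  gcongr
  · simp [abs_of_pos Real.pi_pos]
  have hInt := (integrable_exp_neg_mul_sq hb).const_mul (rexp (1 + L) * rexp (-(ξ / 2)))
  calc _ ≤ ∫ u in (-(π * q ^ 2))..(π * q ^ 2), rexp (1 + L) * rexp (-(ξ / 2))
        * rexp (-(1 / (3 * π ^ 2)) * u ^ 2) := by
        apply intervalIntegral.norm_integral_le_of_norm_le hle
        · filter_upwards with u hu
          exact h j q hq ξ hξ u (abs_le.2 ⟨hu.1.le, hu.2⟩)
        · exact hInt.intervalIntegrable
    _ ≤ ∫ u : ℝ, rexp (1 + L) * rexp (-(ξ / 2)) * rexp (-(1 / (3 * π ^ 2)) * u ^ 2) := by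
        rw [intervalIntegral.integral_of_le hle]
        exact setIntegral_le_integral hInt (Eventually.of_forall fun u => by positivity)
    _ = _ := by
        rw [integral_const_mul]
        ring

lemma continuous_edgeIntegrand (j : ℕ) (q ξ : ℝ) : Continuous (edgeIntegrand j q ξ) := by
  unfold edgeIntegrand edgePhase
  fun_prop

lemma tendsto_edgeFun (j : ℕ) (ξ : ℝ) :
    Tendsto (fun q : ℝ => edgeFun j q ξ) atTop (𝓝 (1 / (2 * π) * airyMoment 0 ξ)) := by
  unfold edgeFun
  refine Tendsto.const_mul _ ?_
  obtain ⟨q₀, h1, h⟩ := exists_norm_edgeIntegrand_le (abs_nonneg ξ)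
  have hb : 0 < 1 / (3 * π ^ 2) := by positivity
  have hInt := (integrable_exp_neg_mul_sq hb).const_mul (rexp (1 + |ξ|) * rexp (-(ξ / 2)))
  have hA : airyMoment 0 ξ = ∫ u, airyIntegrand ξ (-u) := by
    rw [integral_neg_eq_self]
    simp [airyMoment]
  rw [hA]
  have hEq : ∀ q : ℝ, ∫ u in (-(π * q ^ 2))..(π * q ^ 2), edgeIntegrand j q ξ u
      = ∫ u, Set.indicator (Set.Ioc (-(π * q ^ 2)) (π * q ^ 2)) (edgeIntegrand j q ξ) u := by
    intro q
    have hq0 : 0 ≤ π * q ^ 2 := by positivity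
    rw [intervalIntegral.integral_of_le (by linarith), integral_indicator measurableSet_Ioc]
  simp_rw [hEq]
  refine tendsto_integral_filter_of_dominated_convergence _ ?_ ?_ hInt ?_
  · exact Eventually.of_forall fun q =>
      ((continuous_edgeIntegrand j q ξ).measurable.indicator measurableSet_Ioc).aestronglyMeasurable
  · filter_upwards [eventually_ge_atTop q₀] with q hq
    refine Eventually.of_forall fun u => ?_
    by_cases hu : u ∈ Set.Ioc (-(π * q ^ 2)) (π * q ^ 2)
    · rw [Set.indicator_of_mem hu]
      exact h j q hq ξ (neg_abs_le ξ) u (abs_le.2 ⟨hu.1.le, hu.2⟩)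
    · rw [Set.indicator_of_notMem hu, norm_zero]
      positivity
  · refine Eventually.of_forall fun u => ?_
    refine (tendsto_edgeIntegrand j ξ u).congr' ?_
    have ht : Tendsto (fun q : ℝ => π * q ^ 2) atTop atTop :=
      (tendsto_pow_atTop two_ne_zero).const_mul_atTop Real.pi_pos
    filter_upwards [ht.eventually_gt_atTop |u|] with q hq
    rw [Set.indicator_of_mem]
    exact ⟨(abs_lt.1 hq).1, (abs_lt.1 hq).2.le⟩

lemma tendsto_edgeFun_re (j : ℕ) (ξ : ℝ) :
    Tendsto (fun q : ℝ => (edgeFun j q ξ).re) atTop (𝓝 (Ai ξ)) := by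
  have h := (Complex.continuous_re.tendsto _).comp (tendsto_edgeFun j ξ)
  have e : (1 / (2 * π) * airyMoment 0 ξ : ℂ).re = Ai ξ := by
    rw [Ai_eq, show (1 / (2 * π) : ℂ) = ((1 / (2 * π) : ℝ) : ℂ) by push_cast; rfl,
      Complex.re_ofReal_mul]
  rwa [e] at h

lemma hermFun_eq_edgeFun_re {N j : ℕ} {q : ℝ} (hq : 0 < q) (hN : (N : ℝ) = q ^ 6) (hj : j ≤ N)
    (ξ : ℝ) :
    hermFun (N - j) (2 * q ^ 3 + ξ / q) =
      (N - j).factorial * (q ^ 3)⁻¹ ^ (N - j) * (q ^ 2)⁻¹ * rexp (q ^ 6 / 2)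
        * (edgeFun j q ξ).re := by
  have h := congrArg Complex.re (hermFun_eq_edgeFun hq hN hj ξ)
  rw [Complex.ofReal_re] at h
  rw [h, ← Complex.re_ofReal_mul]
  push_cast
  rfl

lemma continuous_edgeFun_re {N j : ℕ} {q : ℝ} (hq : 0 < q) (hN : (N : ℝ) = q ^ 6) (hj : j ≤ N) :
    Continuous fun ξ => (edgeFun j q ξ).re := by
  have h : ∀ ξ, (edgeFun j q ξ).re = ((N - j).factorial * (q ^ 3)⁻¹ ^ (N - j) * (q ^ 2)⁻¹
      * rexp (q ^ 6 / 2))⁻¹ * hermFun (N - j) (2 * q ^ 3 + ξ / q) := by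
    intro ξ
    rw [hermFun_eq_edgeFun_re hq hN hj, ← mul_assoc, inv_mul_cancel₀ (by positivity), one_mul]
  simp_rw [h]
  have := continuous_hermFun (N - j)
  fun_prop

/-- The Hermite kernel rescaled around the edge of its spectrum. -/
noncomputable def edgeKernel (N : ℕ) (ξ η : ℝ) : ℝ :=
  ((N : ℝ) ^ (1 / 6 : ℝ))⁻¹ *
    hermKernel N (2 * ((N : ℝ) ^ (1 / 6 : ℝ)) ^ 3 + ξ / (N : ℝ) ^ (1 / 6 : ℝ))
      (2 * ((N : ℝ) ^ (1 / 6 : ℝ)) ^ 3 + η / (N : ℝ) ^ (1 / 6 : ℝ))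

lemma rpow_sixth_pow (N : ℕ) : (N : ℝ) = ((N : ℝ) ^ (1 / 6 : ℝ)) ^ 6 := by
  rw [← Real.rpow_natCast, ← Real.rpow_mul (Nat.cast_nonneg N)]
  norm_num

lemma tendsto_rpow_sixth : Tendsto (fun N : ℕ => (N : ℝ) ^ (1 / 6 : ℝ)) atTop atTop :=
  (tendsto_rpow_atTop (by norm_num)).comp tendsto_natCast_atTop_atTop

lemma stirling_edge {N : ℕ} {q : ℝ} (hq : 0 < q) (hN : (N : ℝ) = q ^ 6) :
    N.factorial * (q ^ (6 * N))⁻¹ * (q ^ 3)⁻¹ * rexp (q ^ 6) / √(2 * π)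
      = Stirling.stirlingSeq N / √π := by
  have h1 : √(2 * (q ^ 6)) = √2 * q ^ 3 := by
    rw [Real.sqrt_mul (by norm_num), show q ^ 6 = (q ^ 3) ^ 2 by ring, Real.sqrt_sq (by positivity)]
  have h2 : rexp 1 ^ N = rexp (q ^ 6) := by
    rw [← Real.exp_nat_mul, mul_one, hN]
  have h3 : √(2 * π) = √2 * √π := Real.sqrt_mul (by norm_num) π
  rw [Stirling.stirlingSeq, hN, h1, h3, div_pow, h2, ← pow_mul]
  have : 0 < √2 := by positivity
  have : 0 < √π := by positivity
  field_simp

lemma integral_exp_neg_half (a b : ℝ) :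
    ∫ σ in Set.Ioi (0 : ℝ), rexp (-((a + σ) / 2)) * rexp (-((b + σ) / 2)) = rexp (-((a + b) / 2)) := by
  have : ∀ σ : ℝ, rexp (-((a + σ) / 2)) * rexp (-((b + σ) / 2))
      = rexp (-((a + b) / 2)) * rexp (-σ) := by
    intro σ
    rw [← Real.exp_add, ← Real.exp_add]
    congr 1
    ring
  simp_rw [this]
  rw [integral_const_mul, integral_exp_neg_Ioi_zero, mul_one]

lemma integrableOn_exp_neg_half (a b : ℝ) :
    IntegrableOn (fun σ : ℝ => rexp (-((a + σ) / 2)) * rexp (-((b + σ) / 2))) (Set.Ioi 0) := by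
  have : ∀ σ : ℝ, rexp (-((a + σ) / 2)) * rexp (-((b + σ) / 2))
      = rexp (-((a + b) / 2)) * rexp (-σ) := by
    intro σ
    rw [← Real.exp_add, ← Real.exp_add]
    congr 1
    ring
  simp_rw [this]
  exact (integrableOn_exp_neg_Ioi 0).const_mul _

lemma abs_edgeFun_re_mul_le {L q C ξ η : ℝ} {i j : ℕ} (hC : 0 ≤ C)
    (h : ∀ (j : ℕ), ∀ ξ ≥ -L, ‖edgeFun j q ξ‖ ≤ C * rexp (-(ξ / 2)))
    (hξ : -L ≤ ξ) (hη : -L ≤ η) {σ : ℝ} (hσ : 0 ≤ σ) :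
    ‖(edgeFun i q (ξ + σ)).re * (edgeFun j q (η + σ)).re‖ ≤
      C ^ 2 * (rexp (-((ξ + σ) / 2)) * rexp (-((η + σ) / 2))) := by
  rw [norm_mul]
  calc _ ≤ (C * rexp (-((ξ + σ) / 2))) * (C * rexp (-((η + σ) / 2))) := by
        gcongr
        · exact (Complex.abs_re_le_norm _).trans (h _ _ (by linarith))
        · exact (Complex.abs_re_le_norm _).trans (h _ _ (by linarith))
    _ = _ := by ring

lemma edgeKernel_eq_integral {L C : ℝ} {N : ℕ} (hC : 0 ≤ C) (hN : 1 ≤ N)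
    (h : ∀ (j : ℕ), ∀ ξ ≥ -L, ‖edgeFun j ((N : ℝ) ^ (1 / 6 : ℝ)) ξ‖ ≤ C * rexp (-(ξ / 2)))
    {ξ η : ℝ} (hξ : -L ≤ ξ) (hη : -L ≤ η) :
    edgeKernel N ξ η = Stirling.stirlingSeq N / √π / 2 * ∫ σ in Set.Ioi (0 : ℝ),
      ((edgeFun 0 ((N : ℝ) ^ (1 / 6 : ℝ)) (ξ + σ)).re
          * (edgeFun 1 ((N : ℝ) ^ (1 / 6 : ℝ)) (η + σ)).re
        + (edgeFun 1 ((N : ℝ) ^ (1 / 6 : ℝ)) (ξ + σ)).re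
          * (edgeFun 0 ((N : ℝ) ^ (1 / 6 : ℝ)) (η + σ)).re) := by
  have hq : 0 < (N : ℝ) ^ (1 / 6 : ℝ) := Real.rpow_pos_of_pos (by exact_mod_cast hN) _
  have hNq := rpow_sixth_pow N
  rw [edgeKernel]
  set q := (N : ℝ) ^ (1 / 6 : ℝ) with hqdef
  clear_value q
  obtain ⟨M, rfl⟩ : ∃ M, N = M + 1 := ⟨N - 1, by omega⟩
  have hcont0 : Continuous fun ξ => (edgeFun 0 q ξ).re :=
    continuous_edgeFun_re hq hNq (Nat.zero_le _)
  have hcont1 : Continuous fun ξ => (edgeFun 1 q ξ).re := continuous_edgeFun_re hq hNq hN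
  have hcont : Continuous fun σ => (edgeFun 0 q (ξ + σ)).re * (edgeFun 1 q (η + σ)).re
      + (edgeFun 1 q (ξ + σ)).re * (edgeFun 0 q (η + σ)).re :=
    ((hcont0.comp (continuous_const_add ξ)).mul (hcont1.comp (continuous_const_add η))).add
      ((hcont1.comp (continuous_const_add ξ)).mul (hcont0.comp (continuous_const_add η)))
  have hInt : IntegrableOn (fun σ => (edgeFun 0 q (ξ + σ)).re * (edgeFun 1 q (η + σ)).re
      + (edgeFun 1 q (ξ + σ)).re * (edgeFun 0 q (η + σ)).re) (Set.Ioi 0) := by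
    refine Integrable.mono' (((integrableOn_exp_neg_half ξ η).const_mul (C ^ 2)).const_mul 2)
      hcont.aestronglyMeasurable ?_
    refine (ae_restrict_iff' measurableSet_Ioi).2 (Eventually.of_forall fun σ hσ => ?_)
    refine (norm_add_le _ _).trans ?_
    have h1 := abs_edgeFun_re_mul_le (i := 0) (j := 1) hC h hξ hη (le_of_lt hσ)
    have h2 := abs_edgeFun_re_mul_le (i := 1) (j := 0) hC h hξ hη (le_of_lt hσ)
    linarith
  have h0 : ∀ ζ, hermFun (M + 1) (2 * q ^ 3 + ζ / q) = (M + 1).factorial * (q ^ 3)⁻¹ ^ (M + 1)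
      * (q ^ 2)⁻¹ * rexp (q ^ 6 / 2) * (edgeFun 0 q ζ).re := fun ζ =>
    hermFun_eq_edgeFun_re hq hNq (Nat.zero_le _) ζ
  have h1 : ∀ ζ, hermFun M (2 * q ^ 3 + ζ / q) = M.factorial * (q ^ 3)⁻¹ ^ M
      * (q ^ 2)⁻¹ * rexp (q ^ 6 / 2) * (edgeFun 1 q ζ).re := fun ζ =>
    hermFun_eq_edgeFun_re hq hNq hN ζ
  have hs := stirling_edge hq hNq
  set A := Stirling.stirlingSeq (M + 1) / √π with hA
  have hder : ∀ σ ∈ Set.Ici (0 : ℝ), HasDerivAt (fun σ => q⁻¹ * hermKernel (M + 1)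
      (2 * q ^ 3 + ξ / q + σ / q) (2 * q ^ 3 + η / q + σ / q))
      (-(A / 2) * ((edgeFun 0 q (ξ + σ)).re * (edgeFun 1 q (η + σ)).re
      + (edgeFun 1 q (ξ + σ)).re * (edgeFun 0 q (η + σ)).re)) σ := by
    intro σ _
    have hd := (hasDerivAt_hermKernel_diag M (2 * q ^ 3 + ξ / q) (2 * q ^ 3 + η / q) (σ / q)).comp σ
      ((hasDerivAt_id σ).div_const q)
    refine (hd.const_mul q⁻¹).congr_deriv ?_
    have ex : ∀ ζ, 2 * q ^ 3 + ζ / q + σ / q = 2 * q ^ 3 + (ζ + σ) / q := fun ζ => by ring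
    rw [ex, ex, h0, h0, h1, h1, ← hs]
    have he : rexp (q ^ 6) = rexp (q ^ 6 / 2) * rexp (q ^ 6 / 2) := by
      rw [← Real.exp_add]; congr 1; ring
    have hp : q ^ (6 * (M + 1)) = (q ^ 3) ^ (M + 1) * (q ^ 3) ^ M * q ^ 3 := by ring
    rw [he, hp]
    have : 0 < √(2 * π) := by positivity
    have : (0 : ℝ) < M.factorial := by positivity
    generalize (edgeFun 0 q (ξ + σ)).re = a
    generalize (edgeFun 1 q (ξ + σ)).re = b
    generalize (edgeFun 0 q (η + σ)).re = c
    generalize (edgeFun 1 q (η + σ)).re = d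
    simp only [inv_pow]
    generalize (q ^ 3) ^ M = Q at *
    field_simp
  have ht : Tendsto (fun σ => q⁻¹ * hermKernel (M + 1)
      (2 * q ^ 3 + ξ / q + σ / q) (2 * q ^ 3 + η / q + σ / q)) atTop (𝓝 0) := by
    have := ((tendsto_hermKernel_diag (M + 1) (2 * q ^ 3 + ξ / q) (2 * q ^ 3 + η / q)).comp
      (tendsto_id.atTop_div_const hq)).const_mul q⁻¹
    simpa using this
  have hfin := integral_Ioi_of_hasDerivAt_of_tendsto' hder (hInt.const_mul _) ht
  rw [integral_const_mul] at hfin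
  simp only [zero_div, add_zero, zero_sub] at hfin
  linarith

lemma exists_abs_edgeKernel_le {L : ℝ} (hL : 0 ≤ L) :
    ∃ C : ℝ, ∀ᶠ N : ℕ in atTop, ∀ ξ ≥ -L, ∀ η ≥ -L, |edgeKernel N ξ η| ≤ C := by
  obtain ⟨q₀, C, -, hC, h⟩ := exists_norm_edgeFun_le hL
  have hs : ∀ᶠ N : ℕ in atTop, |Stirling.stirlingSeq N / √π| ≤ 2 := by
    have := (Stirling.tendsto_stirlingSeq_sqrt_pi.div_const √π).abs
    rw [div_self (by positivity)] at this
    exact this.eventually_le_const (by norm_num)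
  refine ⟨2 * (C ^ 2 * rexp L), ?_⟩
  filter_upwards [hs, tendsto_rpow_sixth.eventually_ge_atTop q₀, eventually_ge_atTop 1]
    with N hsN hqN hN ξ hξ η hη
  have hb := fun j ξ hξ => h j _ hqN ξ hξ
  rw [edgeKernel_eq_integral hC hN hb hξ hη, abs_mul, abs_div, abs_two]
  have hI : |∫ σ in Set.Ioi (0 : ℝ), ((edgeFun 0 ((N : ℝ) ^ (1 / 6 : ℝ)) (ξ + σ)).re
          * (edgeFun 1 ((N : ℝ) ^ (1 / 6 : ℝ)) (η + σ)).re
        + (edgeFun 1 ((N : ℝ) ^ (1 / 6 : ℝ)) (ξ + σ)).re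
          * (edgeFun 0 ((N : ℝ) ^ (1 / 6 : ℝ)) (η + σ)).re)| ≤ 2 * (C ^ 2 * rexp L) := by
    rw [← Real.norm_eq_abs]
    refine (norm_integral_le_of_norm_le
      (((integrableOn_exp_neg_half ξ η).const_mul (C ^ 2)).const_mul 2) ?_).trans ?_
    · refine (ae_restrict_iff' measurableSet_Ioi).2 (Eventually.of_forall fun σ hσ => ?_)
      refine (norm_add_le _ _).trans ?_
      have h1 := abs_edgeFun_re_mul_le (i := 0) (j := 1) hC hb hξ hη (le_of_lt hσ)
      have h2 := abs_edgeFun_re_mul_le (i := 1) (j := 0) hC hb hξ hη (le_of_lt hσ)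
      linarith
    · rw [integral_const_mul, integral_const_mul, integral_exp_neg_half]
      gcongr
      linarith
  calc _ ≤ 2 / 2 * (2 * (C ^ 2 * rexp L)) := by gcongr
    _ = _ := by ring

lemma tendsto_edgeKernel (ξ η : ℝ) :
    Tendsto (fun N : ℕ => edgeKernel N ξ η) atTop (𝓝 (KAiry ξ η)) := by
  have hL : 0 ≤ |ξ| + |η| := by positivity
  have hξ : -(|ξ| + |η|) ≤ ξ := by linarith [neg_abs_le ξ, abs_nonneg η]
  have hη : -(|ξ| + |η|) ≤ η := by linarith [neg_abs_le η, abs_nonneg ξ]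
  obtain ⟨q₀, C, -, hC, h⟩ := exists_norm_edgeFun_le hL
  have hs : Tendsto (fun N : ℕ => Stirling.stirlingSeq N / √π / 2) atTop (𝓝 (1 / 2)) := by
    have := (Stirling.tendsto_stirlingSeq_sqrt_pi.div_const √π).div_const 2
    rwa [div_self (by positivity)] at this
  have hI : Tendsto (fun N : ℕ => ∫ σ in Set.Ioi (0 : ℝ),
      ((edgeFun 0 ((N : ℝ) ^ (1 / 6 : ℝ)) (ξ + σ)).re
          * (edgeFun 1 ((N : ℝ) ^ (1 / 6 : ℝ)) (η + σ)).re
        + (edgeFun 1 ((N : ℝ) ^ (1 / 6 : ℝ)) (ξ + σ)).re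
          * (edgeFun 0 ((N : ℝ) ^ (1 / 6 : ℝ)) (η + σ)).re)) atTop
      (𝓝 (∫ σ in Set.Ioi (0 : ℝ), (Ai (ξ + σ) * Ai (η + σ) + Ai (ξ + σ) * Ai (η + σ)))) := by
    refine tendsto_integral_filter_of_dominated_convergence _ ?_ ?_
      (((integrableOn_exp_neg_half ξ η).const_mul (C ^ 2)).const_mul 2) ?_
    · filter_upwards [eventually_ge_atTop 1] with N hN
      have hq : 0 < (N : ℝ) ^ (1 / 6 : ℝ) := Real.rpow_pos_of_pos (by exact_mod_cast hN) _
      have hcont0 : Continuous fun ξ => (edgeFun 0 ((N : ℝ) ^ (1 / 6 : ℝ)) ξ).re :=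
        continuous_edgeFun_re hq (rpow_sixth_pow N) (Nat.zero_le _)
      have hcont1 : Continuous fun ξ => (edgeFun 1 ((N : ℝ) ^ (1 / 6 : ℝ)) ξ).re :=
        continuous_edgeFun_re hq (rpow_sixth_pow N) hN
      exact Continuous.aestronglyMeasurable
        (((hcont0.comp (continuous_const_add ξ)).mul (hcont1.comp (continuous_const_add η))).add
          ((hcont1.comp (continuous_const_add ξ)).mul (hcont0.comp (continuous_const_add η))))
    · filter_upwards [tendsto_rpow_sixth.eventually_ge_atTop q₀] with N hqN
      have hb := fun j ξ hξ => h j _ hqN ξ hξ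
      refine (ae_restrict_iff' measurableSet_Ioi).2 (Eventually.of_forall fun σ hσ => ?_)
      refine (norm_add_le _ _).trans ?_
      have h1 := abs_edgeFun_re_mul_le (i := 0) (j := 1) hC hb hξ hη (le_of_lt hσ)
      have h2 := abs_edgeFun_re_mul_le (i := 1) (j := 0) hC hb hξ hη (le_of_lt hσ)
      linarith
    · refine Eventually.of_forall fun σ => ?_
      exact (((tendsto_edgeFun_re 0 _).comp tendsto_rpow_sixth).mul
        ((tendsto_edgeFun_re 1 _).comp tendsto_rpow_sixth)).add
        (((tendsto_edgeFun_re 1 _).comp tendsto_rpow_sixth).mul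
        ((tendsto_edgeFun_re 0 _).comp tendsto_rpow_sixth))
  have hK : KAiry ξ η = 1 / 2 * ∫ σ in Set.Ioi (0 : ℝ),
      (Ai (ξ + σ) * Ai (η + σ) + Ai (ξ + σ) * Ai (η + σ)) := by
    rw [KAiry_eq_integral]
    simp_rw [← two_mul]
    rw [integral_const_mul]
    ring
  rw [hK]
  refine (hs.mul hI).congr' ?_
  filter_upwards [tendsto_rpow_sixth.eventually_ge_atTop q₀, eventually_ge_atTop 1] with N hqN hN
  exact (edgeKernel_eq_integral hC hN (fun j ξ hξ => h j _ hqN ξ hξ) hξ hη).symm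

lemma continuous_det_edgeKernel (n N : ℕ) : Continuous fun t : Fin n → ℝ =>
    Matrix.det (Matrix.of fun j k : Fin n => edgeKernel N (t j) (t k)) := by
  refine Continuous.matrix_det (continuous_matrix fun i j => ?_)
  simp only [Matrix.of_apply, edgeKernel]
  generalize (N : ℝ) ^ (1 / 6 : ℝ) = q
  have h : Continuous fun t : Fin n → ℝ => (2 * q ^ 3 + t i / q, 2 * q ^ 3 + t j / q) := by
    fun_prop
  exact ((continuous_hermKernel N).comp h).const_mul q⁻¹

lemma tendsto_integral_det_edgeKernel (n : ℕ) {f : (Fin n → ℝ) → ℝ} (hf : Continuous f)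
    (hsupp : HasCompactSupport f) :
    Tendsto (fun N : ℕ => ∫ t : Fin n → ℝ,
        f t * Matrix.det (Matrix.of fun j k : Fin n => edgeKernel N (t j) (t k))) atTop
      (𝓝 (∫ t : Fin n → ℝ,
        f t * Matrix.det (Matrix.of fun j k : Fin n => KAiry (t j) (t k)))) := by
  obtain ⟨R, hR⟩ := hsupp.isBounded.subset_closedBall 0
  obtain ⟨C, hC⟩ := exists_abs_edgeKernel_le (abs_nonneg R)
  refine tendsto_integral_filter_of_dominated_convergence
    (fun t => ‖f t‖ * (n.factorial * C ^ n)) ?_ ?_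
    ((hf.integrable_of_hasCompactSupport hsupp).norm.mul_const _) ?_
  · exact Eventually.of_forall fun N =>
      (hf.mul (continuous_det_edgeKernel n N)).aestronglyMeasurable
  · filter_upwards [hC] with N hN
    refine Eventually.of_forall fun t => ?_
    rw [norm_mul]
    by_cases ht : t ∈ tsupport f
    · gcongr
      have hb : ∀ i, -|R| ≤ t i := by
        intro i
        have h1 := hR ht
        rw [Metric.mem_closedBall, dist_zero_right] at h1
        have h2 := (norm_le_pi_norm t i).trans h1
        rw [Real.norm_eq_abs] at h2
        linarith [neg_abs_le (t i), le_abs_self R]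
      have := Matrix.det_le (abv := AbsoluteValue.abs) (x := C)
        (A := Matrix.of fun j k : Fin n => edgeKernel N (t j) (t k))
        (fun i j => hN _ (hb i) _ (hb j))
      simpa using this
    · rw [image_eq_zero_of_notMem_tsupport ht]
      simp
  · refine Eventually.of_forall fun t => Tendsto.const_mul _ ?_
    have hdet : Continuous fun A : Matrix (Fin n) (Fin n) ℝ => A.det :=
      Continuous.matrix_det continuous_id
    refine (hdet.tendsto _).comp ?_
    exact tendsto_pi_nhds.2 fun i => tendsto_pi_nhds.2 fun j => tendsto_edgeKernel _ _

section Combinatorics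

variable {α β R : Type*} [Fintype α] [Fintype β]

lemma exists_perm_eq_sumCongr_left {σ : Equiv.Perm (α ⊕ β)} (h : ∀ b, σ (Sum.inr b) = Sum.inr b) :
    ∃ ρ : Equiv.Perm α, σ = Equiv.sumCongr ρ (Equiv.refl β) := by
  have hr : Set.MapsTo σ (Set.range Sum.inr) (Set.range Sum.inr) := by
    rintro _ ⟨b, rfl⟩
    exact ⟨b, (h b).symm⟩
  obtain ⟨⟨ρ₁, ρ₂⟩, hρ⟩ := Equiv.Perm.mem_sumCongrHom_range_of_perm_mapsTo_inl
    ((Equiv.Perm.perm_mapsTo_inl_iff_mapsTo_inr σ).2 hr)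
  refine ⟨ρ₁, Equiv.ext fun x => ?_⟩
  rcases x with a | b
  · rw [← hρ]
    rfl
  · simp [h b]

lemma exists_perm_eq_sumCongr_right {σ : Equiv.Perm (α ⊕ β)}
    (h : ∀ a, σ (Sum.inl a) = Sum.inl a) :
    ∃ ρ : Equiv.Perm β, σ = Equiv.sumCongr (Equiv.refl α) ρ := by
  have hr : Set.MapsTo σ (Set.range Sum.inl) (Set.range Sum.inl) := by
    rintro _ ⟨b, rfl⟩
    exact ⟨b, (h b).symm⟩
  obtain ⟨⟨ρ₁, ρ₂⟩, hρ⟩ := Equiv.Perm.mem_sumCongrHom_range_of_perm_mapsTo_inl hr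
  refine ⟨ρ₂, Equiv.ext fun x => ?_⟩
  rcases x with a | b
  · simp [h a]
  · rw [← hρ]
    rfl

variable [DecidableEq α] [DecidableEq β]

lemma sum_perm_agree_inr [AddCommMonoid R] (σ : Equiv.Perm (α ⊕ β)) (G : Equiv.Perm (α ⊕ β) → R) :
    ∑ τ, (if ∀ b, σ (Sum.inr b) = τ (Sum.inr b) then G τ else 0) =
      ∑ ρ : Equiv.Perm α, G (σ * Equiv.sumCongr ρ (Equiv.refl β)) := by
  rw [← Finset.sum_filter]
  symm
  refine Finset.sum_bij (fun ρ _ => σ * Equiv.sumCongr ρ (Equiv.refl β)) ?_ ?_ ?_ ?_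
  · intro ρ _
    simp
  · intro ρ₁ _ ρ₂ _ h
    have h' := mul_left_cancel h
    ext a
    have := congrArg (fun e : Equiv.Perm (α ⊕ β) => e (Sum.inl a)) h'
    simpa using this
  · intro τ hτ
    rw [Finset.mem_filter] at hτ
    obtain ⟨ρ, hρ⟩ := exists_perm_eq_sumCongr_left (σ := σ⁻¹ * τ) (fun b => by
      rw [Equiv.Perm.mul_apply, ← hτ.2 b]
      exact σ.symm_apply_apply _)
    exact ⟨ρ, Finset.mem_univ _, by rw [← hρ, mul_inv_cancel_left]⟩
  · intro ρ _
    rfl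

lemma card_perm_extending (σ : Equiv.Perm (α ⊕ β)) :
    (Finset.univ.filter fun τ : Equiv.Perm (α ⊕ β) => (fun a => τ (Sum.inl a))
      = fun a => σ (Sum.inl a)).card = (Fintype.card β).factorial := by
  rw [← Fintype.card_perm, ← Finset.card_univ]
  symm
  refine Finset.card_bij (fun ρ _ => σ * Equiv.sumCongr (Equiv.refl α) ρ) ?_ ?_ ?_
  · intro ρ _
    simp
  · intro ρ₁ _ ρ₂ _ h
    have h' := mul_left_cancel h
    ext b
    have := congrArg (fun e : Equiv.Perm (α ⊕ β) => e (Sum.inr b)) h'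
    simpa using this
  · intro τ hτ
    rw [Finset.mem_filter] at hτ
    obtain ⟨ρ, hρ⟩ := exists_perm_eq_sumCongr_right (σ := σ⁻¹ * τ) (fun a => by
      rw [Equiv.Perm.mul_apply, congrFun hτ.2 a]
      exact σ.symm_apply_apply _)
    exact ⟨ρ, Finset.mem_univ _, by rw [← hρ, mul_inv_cancel_left]⟩

lemma exists_perm_extending {k : α → α ⊕ β} (hk : Function.Injective k) :
    ∃ σ : Equiv.Perm (α ⊕ β), ∀ a, σ (Sum.inl a) = k a := by
  classical
  let e : {x // x ∈ Set.range (Sum.inl : α → α ⊕ β)} ≃ {x // x ∈ Set.range k} :=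
    (Equiv.ofInjective _ Sum.inl_injective).symm.trans (Equiv.ofInjective k hk)
  refine ⟨e.extendSubtype, fun a => ?_⟩
  rw [Equiv.extendSubtype_apply_of_mem e _ ⟨a, rfl⟩]
  have : (Equiv.ofInjective (Sum.inl : α → α ⊕ β) Sum.inl_injective).symm ⟨Sum.inl a, ⟨a, rfl⟩⟩
      = a := Equiv.ofInjective_symm_apply _ a
  simp only [e, Equiv.trans_apply, this, Equiv.ofInjective_apply]

lemma sum_perm_restrict_inl [CommSemiring R] (g : (α → α ⊕ β) → R)
    (hg : ∀ k, ¬ Function.Injective k → g k = 0) :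
    ∑ σ : Equiv.Perm (α ⊕ β), g (fun a => σ (Sum.inl a)) =
      (Fintype.card β).factorial * ∑ k, g k := by
  rw [← Finset.sum_fiberwise' Finset.univ
    (fun (σ : Equiv.Perm (α ⊕ β)) => fun a => σ (Sum.inl a)) g, Finset.mul_sum]
  refine Finset.sum_congr rfl fun k _ => ?_
  rw [Finset.sum_const]
  by_cases hk : Function.Injective k
  · obtain ⟨σ, hσ⟩ := exists_perm_extending hk
    have : k = fun a => σ (Sum.inl a) := funext fun a => (hσ a).symm
    rw [this, card_perm_extending, nsmul_eq_mul]
  · rw [hg k hk, smul_zero, mul_zero]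

lemma det_transpose_mul_self_eq_sum [CommRing R] {κ : Type*} [Fintype κ]
    [DecidableEq κ] (A : Matrix κ α R) :
    (A.transpose * A).det = ∑ k : α → κ, (∏ i, A (k i) i)
      * (Matrix.of fun i j => A (k i) j).det := by
  rw [Matrix.det_apply']
  simp_rw [Matrix.mul_apply, Matrix.transpose_apply, Finset.prod_univ_sum,
    Fintype.piFinset_univ, Finset.mul_sum]
  rw [Finset.sum_comm]
  refine Finset.sum_congr rfl fun k _ => ?_
  rw [← Matrix.det_transpose, Matrix.det_apply', Finset.mul_sum]
  refine Finset.sum_congr rfl fun ρ _ => ?_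
  simp only [Matrix.transpose_apply, Matrix.of_apply, Finset.prod_mul_distrib]
  ring

/-- A form of the Cauchy–Binet formula: the sum over pairs of permutations agreeing on the second
summand. -/
lemma sum_sum_perm_agree_inr_eq [CommRing R] (A : Matrix (α ⊕ β) α R) :
    ∑ σ : Equiv.Perm (α ⊕ β), ∑ τ : Equiv.Perm (α ⊕ β),
      (if ∀ b, σ (Sum.inr b) = τ (Sum.inr b) then
        ((Equiv.Perm.sign σ : ℤ) : R) * ((Equiv.Perm.sign τ : ℤ) : R)
          * ∏ i, A (σ (Sum.inl i)) i * A (τ (Sum.inl i)) i else 0)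
      = (Fintype.card β).factorial * (A.transpose * A).det := by
  rw [det_transpose_mul_self_eq_sum, ← sum_perm_restrict_inl]
  · refine Finset.sum_congr rfl fun σ _ => ?_
    rw [sum_perm_agree_inr, Matrix.det_apply', Finset.mul_sum]
    refine Finset.sum_congr rfl fun ρ _ => ?_
    have hs : ((Equiv.Perm.sign σ : ℤ) : R) * ((Equiv.Perm.sign σ : ℤ) : R) = 1 := by
      rw [← Int.cast_mul, Int.units_coe_mul_self, Int.cast_one]
    have hsp : Equiv.Perm.sign (σ * Equiv.sumCongr ρ (Equiv.refl β))
        = Equiv.Perm.sign σ * Equiv.Perm.sign ρ := by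
      rw [map_mul]
      congr 1
      simp
    rw [hsp]
    simp only [Units.val_mul, Int.cast_mul, Equiv.Perm.mul_apply, Equiv.sumCongr_apply,
      Sum.map_inl, Finset.prod_mul_distrib, Matrix.of_apply]
    linear_combination (((Equiv.Perm.sign ρ : ℤ) : R) * (∏ x, A (σ (Sum.inl x)) x)
      * ∏ x, A (σ (Sum.inl (ρ x))) x) * hs
  · intro k hk
    rw [Function.not_injective_iff] at hk
    obtain ⟨a, b, hab, hne⟩ := hk
    rw [Matrix.det_zero_of_row_eq hne (by ext j; simp [hab]), mul_zero]

end Combinatorics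

section Andreief

variable {α β : Type*} [Fintype α] [Fintype β]

lemma integrable_bounded_mul_prod {F : (α → ℝ) → ℝ} (hF : Measurable F) {C : ℝ}
    (hC : ∀ x, |F x| ≤ C) {h : α → ℝ → ℝ} (hh : ∀ i, Integrable (h i)) :
    Integrable fun x : α → ℝ => F x * ∏ i, h i (x i) :=
  (Integrable.fintype_prod hh).bdd_mul hF.aestronglyMeasurable (Eventually.of_forall hC)

lemma integral_inl_mul_prod (F : (α → ℝ) → ℝ) (h : α ⊕ β → ℝ → ℝ) :
    ∫ z : α ⊕ β → ℝ, F (fun a => z (Sum.inl a)) * ∏ i, h i (z i) =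
      (∫ x : α → ℝ, F x * ∏ i, h (Sum.inl i) (x i)) * ∏ b, ∫ y, h (Sum.inr b) y := by
  rw [← (volume_measurePreserving_sumPiEquivProdPi_symm fun _ : α ⊕ β => ℝ).integral_comp',
    ← integral_fintype_prod_volume_eq_prod (fun b => h (Sum.inr b)), ← integral_prod_mul]
  refine integral_congr_ae (Eventually.of_forall fun p => ?_)
  simp only [Fintype.prod_sum_type]
  rw [mul_assoc]
  rfl

variable [DecidableEq α] [DecidableEq β]

lemma det_sq_eq_sum (φ : α ⊕ β → ℝ → ℝ) (z : α ⊕ β → ℝ) :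
    (Matrix.of fun k i => φ k (z i)).det ^ 2 = ∑ σ : Equiv.Perm (α ⊕ β),
      ∑ τ : Equiv.Perm (α ⊕ β), ((Equiv.Perm.sign σ : ℤ) : ℝ) * ((Equiv.Perm.sign τ : ℤ) : ℝ)
        * ∏ i, φ (σ i) (z i) * φ (τ i) (z i) := by
  rw [sq, Matrix.det_apply', Finset.sum_mul_sum]
  refine Finset.sum_congr rfl fun σ _ => Finset.sum_congr rfl fun τ _ => ?_
  simp only [Matrix.of_apply, Finset.prod_mul_distrib]
  ring

/-- Integrating out the variables of the second summand in the square of the determinant of an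
orthonormal family gives the determinant of the reproducing kernel. -/
lemma integral_inl_mul_det_sq {φ : α ⊕ β → ℝ → ℝ}
    (hφ : ∀ k l, Integrable fun x => φ k x * φ l x)
    (horth : ∀ k l, ∫ x, φ k x * φ l x = if k = l then 1 else 0)
    {F : (α → ℝ) → ℝ} (hF : Measurable F) {C : ℝ} (hC : ∀ x, |F x| ≤ C) :
    ∫ z : α ⊕ β → ℝ, F (fun a => z (Sum.inl a)) * (Matrix.of fun k i => φ k (z i)).det ^ 2 =
      (Fintype.card β).factorial * ∫ x : α → ℝ, F x *
        (Matrix.of fun i j => ∑ k, φ k (x i) * φ k (x j)).det := by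
  have hK : ∀ x : α → ℝ, (Matrix.of fun i j => ∑ k, φ k (x i) * φ k (x j)) =
      (Matrix.of fun k i => φ k (x i)).transpose * (Matrix.of fun k i => φ k (x i)) := by
    intro x
    ext i j
    simp [Matrix.mul_apply]
  rw [← integral_const_mul]
  simp_rw [hK, mul_left_comm _ (F _), ← sum_sum_perm_agree_inr_eq, det_sq_eq_sum, Finset.mul_sum]
  have hInt : ∀ σ τ : Equiv.Perm (α ⊕ β), Integrable fun z : α ⊕ β → ℝ =>
      F (fun a => z (Sum.inl a)) * (((Equiv.Perm.sign σ : ℤ) : ℝ) * ((Equiv.Perm.sign τ : ℤ) : ℝ)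
        * ∏ i, φ (σ i) (z i) * φ (τ i) (z i)) := by
    intro σ τ
    simp_rw [mul_left_comm (F _)]
    refine Integrable.const_mul ?_ _
    exact integrable_bounded_mul_prod (F := fun z : α ⊕ β → ℝ => F fun a => z (Sum.inl a))
      (hF.comp (by fun_prop)) (fun z => hC _) fun i => hφ (σ i) (τ i)
  have hInt' : ∀ σ τ : Equiv.Perm (α ⊕ β), Integrable fun x : α → ℝ =>
      F x * (if ∀ b, σ (Sum.inr b) = τ (Sum.inr b) then
        ((Equiv.Perm.sign σ : ℤ) : ℝ) * ((Equiv.Perm.sign τ : ℤ) : ℝ)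
          * ∏ i, (Matrix.of fun k i => φ k (x i)) (σ (Sum.inl i)) i
            * (Matrix.of fun k i => φ k (x i)) (τ (Sum.inl i)) i else 0) := by
    intro σ τ
    split_ifs
    · simp_rw [mul_left_comm (F _)]
      refine Integrable.const_mul ?_ _
      exact integrable_bounded_mul_prod hF hC fun i => hφ (σ (Sum.inl i)) (τ (Sum.inl i))
    · simp
  rw [integral_finsetSum _ fun σ _ => integrable_finsetSum _ fun τ _ => hInt σ τ,
    integral_finsetSum _ fun σ _ => integrable_finsetSum _ fun τ _ => hInt' σ τ]
  refine Finset.sum_congr rfl fun σ _ => ?_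
  rw [integral_finsetSum _ fun τ _ => hInt σ τ, integral_finsetSum _ fun τ _ => hInt' σ τ]
  refine Finset.sum_congr rfl fun τ _ => ?_
  simp_rw [mul_left_comm (F _)]
  rw [integral_const_mul, integral_inl_mul_prod F fun i x => φ (σ i) x * φ (τ i) x]
  simp_rw [horth]
  split_ifs with h
  · simp_rw [mul_left_comm (F _)]
    rw [integral_const_mul, Finset.prod_eq_one, mul_one]
    · rfl
    · intro b _
      rw [if_pos (h b)]
  · obtain ⟨b, hb⟩ := not_forall.1 h
    rw [Finset.prod_eq_zero (Finset.mem_univ b) (if_neg hb)]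
    simp

end Andreief

lemma vand_two_eq_det_vandermonde_sq (N : ℕ) (x : Fin N → ℝ) :
    vand 2 N x = (Matrix.vandermonde x).det ^ 2 := by
  rw [Matrix.det_vandermonde, vand, ← Finset.prod_pow]
  simp_rw [← Finset.prod_pow]
  rw [Finset.prod_sigma', Finset.prod_filter, ← Finset.univ_product_univ, Finset.prod_product,
    Finset.prod_sigma]
  refine Finset.prod_congr rfl fun i _ => ?_
  rw [← Finset.prod_filter]
  refine Finset.prod_congr (by ext; simp) fun j _ => ?_
  rw [Real.rpow_two, sq_abs]
  ring

lemma continuous_vand_two (N : ℕ) : Continuous (vand 2 N) := by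
  have : vand 2 N = fun x => (Matrix.vandermonde x).det ^ 2 :=
    funext fun x => vand_two_eq_det_vandermonde_sq N x
  rw [this]
  refine (Continuous.matrix_det (continuous_matrix fun i j => ?_)).pow 2
  simp only [Matrix.vandermonde_apply]
  fun_prop

lemma vand_nonneg (b : ℝ) (N : ℕ) (x : Fin N → ℝ) : 0 ≤ vand b N x :=
  Finset.prod_nonneg fun _ _ => Real.rpow_nonneg (abs_nonneg _) _

lemma vand_two_eq_det_herm_sq (N : ℕ) (x : Fin N → ℝ) :
    vand 2 N x = (Matrix.of fun k i : Fin N => herm k (x i)).det ^ 2 := by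
  rw [vand_two_eq_det_vandermonde_sq, Matrix.det_eval_matrixOfPolynomials_eq_det_vandermonde x
    (fun k => (Polynomial.hermite k).map (Int.castRingHom ℝ)), ← Matrix.det_transpose]
  · congr 2
    ext i j
    simp [herm_eq_eval]
  · intro i
    rw [(Polynomial.hermite_monic i).natDegree_map, Polynomial.natDegree_hermite]
  · intro i
    exact (Polynomial.hermite_monic i).map _

/-- The unnormalized eigenvalue density of the Gaussian unitary ensemble. -/
noncomputable def gueWeight (N : ℕ) (x : Fin N → ℝ) : ℝ :=
  vand 2 N x * rexp (-(∑ i, x i ^ 2) / 2)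

/-- The orthonormal Hermite functions. -/
noncomputable def hermOrtho (k : ℕ) (x : ℝ) : ℝ :=
  (√(k.factorial * √(2 * π)))⁻¹ * hermFun k x

lemma integrable_hermOrtho_mul (k l : ℕ) : Integrable fun x => hermOrtho k x * hermOrtho l x := by
  have h := (integrable_hermFun_mul_hermFun k l).const_mul
    ((√(k.factorial * √(2 * π)))⁻¹ * (√(l.factorial * √(2 * π)))⁻¹)
  refine h.congr (Eventually.of_forall fun x => ?_)
  simp only [hermOrtho]
  ring

lemma integral_hermOrtho_mul (k l : ℕ) :
    ∫ x, hermOrtho k x * hermOrtho l x = if k = l then 1 else 0 := by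
  have h : ∀ x, hermOrtho k x * hermOrtho l x = ((√(k.factorial * √(2 * π)))⁻¹
      * (√(l.factorial * √(2 * π)))⁻¹) * (hermFun k x * hermFun l x) := fun x => by
    simp only [hermOrtho]
    ring
  simp_rw [h]
  rw [integral_const_mul, integral_hermFun_mul_hermFun]
  split_ifs with hkl
  · subst hkl
    rw [← mul_inv, Real.mul_self_sqrt (by positivity)]
    exact inv_mul_cancel₀ (by positivity)
  · simp

lemma sum_hermOrtho_mul (N : ℕ) (x y : ℝ) :
    ∑ k : Fin N, hermOrtho k x * hermOrtho k y = hermKernel N x y := by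
  rw [hermKernel, ← Fin.sum_univ_eq_sum_range
    (fun k => hermFun k x * hermFun k y / (k.factorial * √(2 * π)))]
  refine Finset.sum_congr rfl fun k _ => ?_
  have : hermOrtho k x * hermOrtho k y
      = (√((k : ℕ).factorial * √(2 * π)) * √((k : ℕ).factorial * √(2 * π)))⁻¹
        * (hermFun k x * hermFun k y) := by
    simp only [hermOrtho, mul_inv]
    ring
  rw [this, Real.mul_self_sqrt (by positivity)]
  ring

lemma exists_gueWeight_eq (N : ℕ) : ∃ c : ℝ, 0 < c ∧ ∀ x : Fin N → ℝ,
    gueWeight N x = c * (Matrix.of fun k i : Fin N => hermOrtho k (x i)).det ^ 2 := by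
  refine ⟨∏ k : Fin N, ((k : ℕ).factorial * √(2 * π)), Finset.prod_pos fun k _ => by positivity,
    fun x => ?_⟩
  have h : (Matrix.of fun k i : Fin N => hermOrtho k (x i)) =
      Matrix.of fun k i : Fin N => (√((k : ℕ).factorial * √(2 * π)))⁻¹ *
        (Matrix.of fun k i : Fin N => rexp (-(x i ^ 2 / 4)) *
          (Matrix.of fun k i : Fin N => herm k (x i)) k i) k i := by
    ext k i
    simp only [Matrix.of_apply, hermOrtho, hermFun]
    ring
  rw [h, Matrix.det_mul_column (fun k : Fin N => (√((k : ℕ).factorial * √(2 * π)))⁻¹),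
    Matrix.det_mul_row (fun i : Fin N => rexp (-(x i ^ 2 / 4))), gueWeight,
    vand_two_eq_det_herm_sq, mul_pow, mul_pow, ← Finset.prod_pow, ← Finset.prod_pow]
  have h1 : ∏ k : Fin N, (√((k : ℕ).factorial * √(2 * π)))⁻¹ ^ 2
      = (∏ k : Fin N, ((k : ℕ).factorial * √(2 * π)))⁻¹ := by
    rw [← Finset.prod_inv_distrib]
    refine Finset.prod_congr rfl fun k _ => ?_
    rw [inv_pow, Real.sq_sqrt (by positivity)]
  have h2 : ∏ i, rexp (-(x i ^ 2 / 4)) ^ 2 = rexp (-(∑ i, x i ^ 2) / 2) := by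
    simp_rw [← Real.exp_nat_mul]
    rw [← Real.exp_sum]
    congr 1
    rw [neg_div, Finset.sum_div, ← Finset.sum_neg_distrib]
    refine Finset.sum_congr rfl fun i _ => ?_
    push_cast
    ring
  rw [h1, h2]
  have : ∏ k : Fin N, (((k : ℕ).factorial : ℝ) * √(2 * π)) ≠ 0 :=
    (Finset.prod_pos fun k _ => by positivity).ne'
  generalize ∏ k : Fin N, (((k : ℕ).factorial : ℝ) * √(2 * π)) = P at this ⊢
  field_simp

/-- Splitting `Fin N` into its first `n` elements and the rest. -/
def finSplit {n N : ℕ} (h : n ≤ N) : Fin n ⊕ Fin (N - n) ≃ Fin N :=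
  finSumFinEquiv.trans (finCongr (Nat.add_sub_of_le h))

lemma finSplit_inl {n N : ℕ} (h : n ≤ N) (a : Fin n) :
    finSplit h (Sum.inl a) = Fin.castLE h a := by
  ext
  simp [finSplit]

lemma finSplit_inr_val {n N : ℕ} (h : n ≤ N) (b : Fin (N - n)) :
    (finSplit h (Sum.inr b) : ℕ) = n + b := by
  simp [finSplit]

lemma combine_finSplit {n N : ℕ} (h : n ≤ N) (x : Fin n → ℝ) (y : Fin (N - n) → ℝ)
    (i : Fin n ⊕ Fin (N - n)) : combine N n x y (finSplit h i) = Sum.elim x y i := by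
  rcases i with a | b
  · rw [finSplit_inl]
    simp [combine]
  · have hv := finSplit_inr_val h b
    rw [combine, dif_neg (by omega)]
    simp [hv]

lemma measurePreserving_finSplit {n N : ℕ} (h : n ≤ N) :
    MeasurePreserving (MeasurableEquiv.piCongrLeft (fun _ : Fin N => ℝ) (finSplit h))
      volume volume :=
  volume_measurePreserving_piCongrLeft (fun _ : Fin N => ℝ) (finSplit h)

lemma piCongrLeft_finSplit_apply {n N : ℕ} (h : n ≤ N) (z : Fin n ⊕ Fin (N - n) → ℝ)
    (i : Fin n ⊕ Fin (N - n)) :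
    MeasurableEquiv.piCongrLeft (fun _ : Fin N => ℝ) (finSplit h) z (finSplit h i) = z i :=
  Equiv.piCongrLeft_apply_apply (fun _ : Fin N => ℝ) (finSplit h) z i

lemma det_hermOrtho_finSplit {n N : ℕ} (h : n ≤ N) (z : Fin n ⊕ Fin (N - n) → ℝ) :
    (Matrix.of fun k i : Fin N => hermOrtho k
      (MeasurableEquiv.piCongrLeft (fun _ : Fin N => ℝ) (finSplit h) z i)).det =
    (Matrix.of fun k i => hermOrtho (finSplit h k) (z i)).det := by
  rw [← Matrix.det_submatrix_equiv_self (finSplit h)]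
  congr 1
  ext k i
  simp only [Matrix.submatrix_apply, Matrix.of_apply, piCongrLeft_finSplit_apply]

lemma integral_castLE_mul_gueWeight_aux {n N : ℕ} (h : n ≤ N) {c : ℝ}
    (hc : ∀ x : Fin N → ℝ,
      gueWeight N x = c * (Matrix.of fun k i : Fin N => hermOrtho k (x i)).det ^ 2)
    {F : (Fin n → ℝ) → ℝ} (hF : Measurable F) {C : ℝ} (hC : ∀ x, |F x| ≤ C) :
    ∫ x : Fin N → ℝ, F (fun a => x (Fin.castLE h a)) * gueWeight N x =
      c * ((N - n).factorial * ∫ x : Fin n → ℝ, F x *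
        (Matrix.of fun i j => hermKernel N (x i) (x j)).det) := by
  rw [← (measurePreserving_finSplit h).integral_comp']
  have hker : ∀ x y : ℝ, hermKernel N x y
      = ∑ k, hermOrtho (finSplit h k) x * hermOrtho (finSplit h k) y := by
    intro x y
    rw [← sum_hermOrtho_mul]
    exact (Equiv.sum_comp (finSplit h) fun k : Fin N => hermOrtho k x * hermOrtho k y).symm
  have key := integral_inl_mul_det_sq (φ := fun k => hermOrtho (finSplit h k))
    (fun k l => integrable_hermOrtho_mul _ _) (fun k l => by
      rw [integral_hermOrtho_mul]
      congr 1
      rw [Fin.val_inj, (finSplit h).apply_eq_iff_eq]) hF hC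
  rw [Fintype.card_fin] at key
  simp_rw [hker]
  rw [← key, ← integral_const_mul]
  refine integral_congr_ae (Eventually.of_forall fun z => ?_)
  simp only
  rw [hc, det_hermOrtho_finSplit h z]
  simp_rw [← finSplit_inl h, piCongrLeft_finSplit_apply]
  ring

lemma integral_gueWeight_pos (N : ℕ) : 0 < ∫ x, gueWeight N x := by
  obtain ⟨c, hc0, hc⟩ := exists_gueWeight_eq N
  have h := integral_castLE_mul_gueWeight_aux (Nat.zero_le N) hc (F := fun _ => 1)
    measurable_const (C := 1) (by simp)
  simp only [one_mul, Matrix.det_isEmpty, Nat.sub_zero] at h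
  rw [h, integral_const]
  simp only [measureReal_def, volume_pi, Measure.pi_univ]
  simp
  positivity

lemma integrable_gueWeight (N : ℕ) : Integrable (gueWeight N) :=
  not_imp_comm.1 integral_undef (integral_gueWeight_pos N).ne'

/-- The correlation functions of the Gaussian unitary ensemble are determinants of the Hermite
kernel. -/
lemma integral_castLE_mul_gueWeight {n N : ℕ} (h : n ≤ N)
    {F : (Fin n → ℝ) → ℝ} (hF : Measurable F) {C : ℝ} (hC : ∀ x, |F x| ≤ C) :
    N.factorial / (N - n).factorial *
      ∫ x : Fin N → ℝ, F (fun a => x (Fin.castLE h a)) * gueWeight N x =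
      (∫ x, gueWeight N x) * ∫ x : Fin n → ℝ, F x *
        (Matrix.of fun i j => hermKernel N (x i) (x j)).det := by
  obtain ⟨c, hc0, hc⟩ := exists_gueWeight_eq N
  have h0 := integral_castLE_mul_gueWeight_aux (Nat.zero_le N) hc (F := fun _ => 1)
    measurable_const (C := 1) (by simp)
  have h1 := integral_castLE_mul_gueWeight_aux h hc hF hC
  simp only [one_mul, Matrix.det_isEmpty, Nat.sub_zero] at h0
  rw [h0, h1, integral_const]
  simp only [measureReal_def, volume_pi, Measure.pi_univ]
  simp
  field_simp

section Transfer

variable {n : ℕ}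

/-- The affine map induced in edge coordinates by a dilation with factor `s`. -/
def edgeDilate (n : ℕ) (a s : ℝ) (t : Fin n → ℝ) : Fin n → ℝ := fun i => s * t i + (s - 1) * a

lemma continuous_edgeDilate (n : ℕ) (a : ℝ) :
    Continuous fun p : ℝ × (Fin n → ℝ) => edgeDilate n a p.1 p.2 := by
  unfold edgeDilate
  fun_prop

lemma norm_edgeDilate_sub_le {a s d R : ℝ} {t : Fin n → ℝ} (ha : 0 < a) (hs : |s - 1| ≤ d / a)
    (ht : ‖t‖ ≤ R) (hR : R ≤ a) (hd : 0 ≤ d) : ‖edgeDilate n a s t - t‖ ≤ 2 * d := by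
  refine (pi_norm_le_iff_of_nonneg (by positivity)).2 fun i => ?_
  have hti : |t i| ≤ a := ((norm_le_pi_norm t i).trans ht).trans hR
  have e : (edgeDilate n a s t - t) i = (s - 1) * (t i + a) := by
    simp only [edgeDilate, Pi.sub_apply]
    ring
  rw [e, norm_mul, Real.norm_eq_abs, Real.norm_eq_abs]
  have h1 : |t i + a| ≤ 2 * a := by
    refine (abs_add_le _ _).trans ?_
    rw [abs_of_pos ha]
    linarith
  calc |s - 1| * |t i + a| ≤ d / a * (2 * a) := by gcongr
    _ = 2 * d := by field_simp

lemma norm_le_of_norm_edgeDilate_le {a s d R : ℝ} {t : Fin n → ℝ} (ha : 2 ≤ a)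
    (hs : |s - 1| ≤ d / a) (hd1 : d ≤ 1) (ht : ‖edgeDilate n a s t‖ ≤ R) :
    ‖t‖ ≤ 2 * R + 2 := by
  have hR : 0 ≤ R := (norm_nonneg _).trans ht
  refine (pi_norm_le_iff_of_nonneg (by positivity)).2 fun i => ?_
  have hti : |edgeDilate n a s t i| ≤ R := (norm_le_pi_norm _ i).trans ht
  have hda : d / a ≤ 1 / 2 := by
    rw [div_le_iff₀ (by linarith)]
    linarith
  have hs2 : 1 / 2 ≤ s := by linarith [(abs_le.1 hs).1]
  have h2 : |(s - 1) * a| ≤ 1 := by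
    rw [abs_mul, abs_of_pos (by linarith : (0 : ℝ) < a)]
    calc |s - 1| * a ≤ d / a * a := by gcongr
      _ = d := by field_simp
      _ ≤ 1 := hd1
  have h3 : |s * t i| ≤ R + 1 := by
    have : s * t i = edgeDilate n a s t i - (s - 1) * a := by
      simp only [edgeDilate]
      ring
    rw [this]
    exact (abs_sub _ _).trans (by linarith)
  rw [abs_mul, abs_of_pos (by linarith)] at h3
  rw [Real.norm_eq_abs]
  nlinarith [abs_nonneg (t i)]

variable {m : ℕ → Measure (Fin n → ℝ)} {p : ℕ → Measure ℝ} [∀ N, IsFiniteMeasure (m N)]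
  [∀ N, IsProbabilityMeasure (p N)] {a M : ℕ → ℝ}

lemma exists_abs_le_of_hasCompactSupport {f : (Fin n → ℝ) → ℝ} (hf : Continuous f)
    (hsupp : HasCompactSupport f) : ∃ C, 0 ≤ C ∧ ∀ t, |f t| ≤ C := by
  obtain ⟨C, hC⟩ := hsupp.exists_bound_of_continuous hf
  exact ⟨C, (norm_nonneg _).trans (hC 0), hC⟩

lemma integrable_edgeDilate {μ : Measure (Fin n → ℝ)} [IsFiniteMeasure μ] {f : (Fin n → ℝ) → ℝ}
    (hf : Continuous f) (hsupp : HasCompactSupport f) (b s : ℝ) :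
    Integrable (fun t => f (edgeDilate n b s t)) μ := by
  obtain ⟨C, -, hC⟩ := exists_abs_le_of_hasCompactSupport hf hsupp
  refine Integrable.of_bound (C := C) (Continuous.aestronglyMeasurable ?_)
    (Eventually.of_forall fun t => hC _)
  exact hf.comp ((continuous_edgeDilate n b).comp (by fun_prop : Continuous fun t => (s, t)))

lemma integrable_integral_edgeDilate {μ : Measure (Fin n → ℝ)} [IsFiniteMeasure μ]
    {ρ : Measure ℝ} [IsFiniteMeasure ρ] {f : (Fin n → ℝ) → ℝ}
    (hf : Continuous f) (hsupp : HasCompactSupport f) (b : ℝ) :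
    Integrable (fun s => ∫ t, f (edgeDilate n b s t) ∂μ) ρ := by
  obtain ⟨C, -, hC⟩ := exists_abs_le_of_hasCompactSupport hf hsupp
  have : Integrable (fun z : ℝ × (Fin n → ℝ) => f (edgeDilate n b z.1 z.2)) (ρ.prod μ) :=
    Integrable.of_bound (C := C) (hf.comp (continuous_edgeDilate n b)).aestronglyMeasurable
      (Eventually.of_forall fun t => hC _)
  exact this.integral_prod_left

lemma exists_measureReal_closedBall_le
    {L : ((Fin n → ℝ) → ℝ) → ℝ}
    (ha : Tendsto a atTop atTop) (hM : ∀ᶠ N in atTop, 1 ≤ M N)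
    (hp : ∀ d > 0, Tendsto (fun N => (p N).real {s | d / a N < |s - 1|} * M N) atTop (𝓝 0))
    (hL : ∀ f : (Fin n → ℝ) → ℝ, Continuous f → HasCompactSupport f →
      Tendsto (fun N => ∫ s, ∫ t, f (edgeDilate n (a N) s t) ∂(m N) ∂(p N)) atTop (𝓝 (L f)))
    (R : ℝ) :
    ∃ C, ∀ᶠ N in atTop, (m N).real (Metric.closedBall 0 R) ≤ C := by
  obtain ⟨g, hg1, -, hgc, hg⟩ := exists_continuous_one_zero_of_isCompact
    (isCompact_closedBall (0 : Fin n → ℝ) (R + 2)) (isClosed_empty) (Set.disjoint_empty _)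
  have hg0 : ∀ t, 0 ≤ g t := fun t => (hg t).1
  refine ⟨2 * (L g + 1), ?_⟩
  have hbad : ∀ᶠ N in atTop, (p N).real {s | 1 / a N < |s - 1|} * M N ≤ 1 / 2 :=
    (hp 1 one_pos).eventually_le_const (by norm_num)
  filter_upwards [hbad, hM, ha.eventually_ge_atTop R, ha.eventually_gt_atTop 0,
    (hL g g.continuous hgc).eventually_le_const (lt_add_one (L g))] with N hN hMN hR ha0 hLN
  set bad : Set ℝ := {s | 1 / a N < |s - 1|} with hbaddef
  have hbm : MeasurableSet bad :=
    measurableSet_lt measurable_const (by fun_prop)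
  have hpb : (p N).real bad ≤ 1 / 2 := by
    have : 0 ≤ (p N).real bad := measureReal_nonneg
    nlinarith
  have hpg : 1 / 2 ≤ (p N).real badᶜ := by
    rw [probReal_compl_eq_one_sub hbm]
    linarith
  have hG : ∀ s ∈ badᶜ, (m N).real (Metric.closedBall 0 R)
      ≤ ∫ t, g (edgeDilate n (a N) s t) ∂(m N) := by
    intro s hs
    have hs' : |s - 1| ≤ 1 / a N := not_lt.1 hs
    rw [← integral_indicator_one Metric.isClosed_closedBall.measurableSet]
    refine integral_mono ((integrable_const (1 : ℝ)).indicator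
      Metric.isClosed_closedBall.measurableSet) (integrable_edgeDilate g.continuous hgc _ _) ?_
    intro t
    by_cases ht : t ∈ Metric.closedBall (0 : Fin n → ℝ) R
    · have ht' : ‖t‖ ≤ R := by simpa using ht
      simp only [Set.indicator_of_mem ht, Pi.one_apply]
      have hd := norm_edgeDilate_sub_le ha0 hs' ht' hR zero_le_one
      have : edgeDilate n (a N) s t ∈ Metric.closedBall (0 : Fin n → ℝ) (R + 2) := by
        rw [Metric.mem_closedBall, dist_zero_right]
        have := norm_add_le (edgeDilate n (a N) s t - t) t
        rw [sub_add_cancel] at this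
        linarith
      exact (hg1 this).symm.le
    · simp only [Set.indicator_of_notMem ht]
      exact hg0 _
  have h1 : (m N).real (Metric.closedBall 0 R) * (p N).real badᶜ
      ≤ ∫ s, ∫ t, g (edgeDilate n (a N) s t) ∂(m N) ∂(p N) := by
    have hInt := integrable_integral_edgeDilate (μ := m N) (ρ := p N) g.continuous hgc (a N)
    refine le_trans ?_ (setIntegral_le_integral (s := badᶜ) hInt
      (Eventually.of_forall fun s => integral_nonneg fun t => hg0 _))
    have := setIntegral_mono_on (μ := p N)
      (f := fun _ => (m N).real (Metric.closedBall 0 R)) (integrableOn_const (by simp))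
      hInt.integrableOn hbm.compl hG
    rw [setIntegral_const, smul_eq_mul] at this
    linarith
  have h0 : 0 ≤ (m N).real (Metric.closedBall 0 R) := measureReal_nonneg
  nlinarith

/-- Removing a random dilation which is sufficiently concentrated around `1`. -/
lemma tendsto_integral_of_edgeDilate
    {L : ((Fin n → ℝ) → ℝ) → ℝ}
    (ha : Tendsto a atTop atTop) (hM : ∀ᶠ N in atTop, 1 ≤ M N)
    (hm : ∀ᶠ N in atTop, (m N).real Set.univ ≤ M N)
    (hp : ∀ d > 0, Tendsto (fun N => (p N).real {s | d / a N < |s - 1|} * M N) atTop (𝓝 0))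
    (hL : ∀ f : (Fin n → ℝ) → ℝ, Continuous f → HasCompactSupport f →
      Tendsto (fun N => ∫ s, ∫ t, f (edgeDilate n (a N) s t) ∂(m N) ∂(p N)) atTop (𝓝 (L f)))
    {f : (Fin n → ℝ) → ℝ} (hf : Continuous f) (hsupp : HasCompactSupport f) :
    Tendsto (fun N => ∫ t, f t ∂(m N)) atTop (𝓝 (L f)) := by
  obtain ⟨R₀, hR₀⟩ := hsupp.isBounded.subset_closedBall 0
  set R := |R₀| with hRdef
  have hfR : ∀ t, R < ‖t‖ → f t = 0 := by
    intro t ht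
    by_contra h
    have := hR₀ (subset_tsupport f h)
    rw [Metric.mem_closedBall, dist_zero_right] at this
    linarith [le_abs_self R₀]
  have hRn : 0 ≤ R := abs_nonneg _
  obtain ⟨K, hK0, hK⟩ := exists_abs_le_of_hasCompactSupport hf hsupp
  obtain ⟨C, hC⟩ := exists_measureReal_closedBall_le ha hM hp hL (2 * R + 2)
  suffices h : Tendsto (fun N => (∫ t, f t ∂(m N))
      - ∫ s, ∫ t, f (edgeDilate n (a N) s t) ∂(m N) ∂(p N)) atTop (𝓝 0) by
    simpa using h.add (hL f hf hsupp)
  rw [Metric.tendsto_nhds]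
  intro ε hε
  have hC1 : 0 < |C| + 1 := by positivity
  obtain ⟨η, hη, hunif⟩ := Metric.uniformContinuous_iff.1
    (hsupp.uniformContinuous_of_continuous hf) (ε / 2 / (|C| + 1)) (by positivity)
  set d := min 1 (η / 4) with hd
  have hd0 : 0 < d := by positivity
  have hd1 : d ≤ 1 := min_le_left _ _
  have hdη : 2 * d < η := by
    have : d ≤ η / 4 := min_le_right _ _
    linarith
  have hbad : ∀ᶠ N in atTop, (p N).real {s | d / a N < |s - 1|} * M N * (2 * K) < ε / 2 := by
    have := (hp d hd0).mul_const (2 * K)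
    rw [zero_mul] at this
    exact this.eventually_lt_const (by positivity)
  filter_upwards [hbad, hC, hm, ha.eventually_ge_atTop 2, ha.eventually_ge_atTop (2 * R + 2)]
    with N hN hCN hmN ha2 haR
  have ha0 : 0 < a N := by linarith
  set bad : Set ℝ := {s | d / a N < |s - 1|} with hbaddef
  have hbm : MeasurableSet bad := measurableSet_lt measurable_const (by fun_prop)
  have hfm : Integrable f (m N) := Integrable.of_bound (C := K) hf.aestronglyMeasurable
    (Eventually.of_forall hK)
  have hgood : ∀ s, s ∉ bad → |(∫ t, f t ∂(m N)) - ∫ t, f (edgeDilate n (a N) s t) ∂(m N)|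
      ≤ ε / 2 / (|C| + 1) * |C| := by
    intro s hs
    have hs' : |s - 1| ≤ d / a N := not_lt.1 hs
    rw [← integral_sub hfm (integrable_edgeDilate hf hsupp _ _), ← Real.norm_eq_abs]
    have hpt : ∀ t, ‖f t - f (edgeDilate n (a N) s t)‖ ≤
        Set.indicator (Metric.closedBall (0 : Fin n → ℝ) (2 * R + 2))
          (fun _ => ε / 2 / (|C| + 1)) t := by
      intro t
      by_cases ht : ‖t‖ ≤ 2 * R + 2
      · rw [Set.indicator_of_mem (by simpa using ht)]
        have h2 := norm_edgeDilate_sub_le ha0 hs' ht haR hd0.le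
        have h3 : dist t (edgeDilate n (a N) s t) < η := by
          rw [dist_comm, dist_eq_norm]
          linarith
        exact (hunif h3).le
      · rw [Set.indicator_of_notMem (by simpa using ht), hfR t (by linarith), hfR, sub_zero,
          norm_zero]
        by_contra hcon
        exact ht (norm_le_of_norm_edgeDilate_le ha2 hs' hd1 (not_lt.1 hcon))
    refine (norm_integral_le_of_norm_le ((integrable_const _).indicator
      Metric.isClosed_closedBall.measurableSet) (Eventually.of_forall hpt)).trans ?_
    rw [integral_indicator Metric.isClosed_closedBall.measurableSet, setIntegral_const,
      smul_eq_mul, mul_comm]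
    gcongr
    exact hCN.trans (le_abs_self C)
  have hall : ∀ s, |(∫ t, f t ∂(m N)) - ∫ t, f (edgeDilate n (a N) s t) ∂(m N)|
      ≤ 2 * K * M N := by
    intro s
    rw [← integral_sub hfm (integrable_edgeDilate hf hsupp _ _), ← Real.norm_eq_abs]
    refine (norm_integral_le_of_norm_le (integrable_const (2 * K))
      (Eventually.of_forall fun t => ?_)).trans ?_
    · refine (norm_sub_le _ _).trans ?_
      have h1 := hK t
      have h2 := hK (edgeDilate n (a N) s t)
      rw [Real.norm_eq_abs, Real.norm_eq_abs]
      linarith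
    · rw [integral_const, smul_eq_mul, mul_comm]
      gcongr
  have hconst : (∫ t, f t ∂(m N)) = ∫ _s, (∫ t, f t ∂(m N)) ∂(p N) := by simp
  rw [dist_zero_right]
  rw [hconst, ← integral_sub (integrable_const _) (integrable_integral_edgeDilate hf hsupp _)]
  have hM0 : 0 ≤ M N := measureReal_nonneg.trans hmN
  refine (norm_integral_le_of_norm_le (g := fun s => ε / 2 / (|C| + 1) * |C|
    + bad.indicator (fun _ => 2 * K * M N) s)
    ((integrable_const _).add ((integrable_const _).indicator hbm))
    (Eventually.of_forall fun s => ?_)).trans_lt ?_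
  · by_cases hs : s ∈ bad
    · rw [Set.indicator_of_mem hs]
      have : 0 ≤ ε / 2 / (|C| + 1) * |C| := by positivity
      exact (hall s).trans (by linarith)
    · rw [Set.indicator_of_notMem hs, add_zero]
      exact hgood s hs
  · rw [integral_add (integrable_const _) ((integrable_const _).indicator hbm),
      integral_indicator hbm, setIntegral_const, integral_const]
    simp only [probReal_univ, smul_eq_mul, one_mul]
    have h1 : ε / 2 / (|C| + 1) * |C| ≤ ε / 2 := by
      rw [div_mul_eq_mul_div, div_le_iff₀ hC1]
      nlinarith [abs_nonneg C]
    have h2 : (p N).real bad * (2 * K * M N) = (p N).real bad * M N * (2 * K) := by ring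
    linarith

end Transfer

/-- The unnormalized eigenvalue density of the bounded trace unitary ensemble of strength `r`. -/
noncomputable def btWeight (N : ℕ) (r : ℝ) (x : Fin N → ℝ) : ℝ :=
  Set.indicator {z : Fin N → ℝ | ∑ i, z i ^ 2 ≤ r ^ 2} (vand 2 N) x

lemma btWeight_nonneg (N : ℕ) (r : ℝ) (x : Fin N → ℝ) : 0 ≤ btWeight N r x :=
  Set.indicator_nonneg (fun _ _ => vand_nonneg _ _ _) x

lemma isClosed_setOf_sum_sq_le (N : ℕ) (r : ℝ) :
    IsClosed {z : Fin N → ℝ | ∑ i, z i ^ 2 ≤ r ^ 2} :=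
  isClosed_le (by fun_prop) continuous_const

lemma measurable_btWeight (N : ℕ) (r : ℝ) : Measurable (btWeight N r) :=
  (continuous_vand_two N).measurable.indicator (isClosed_setOf_sum_sq_le N r).measurableSet

lemma integrable_btWeight (N : ℕ) (r : ℝ) : Integrable (btWeight N r) := by
  have hK : IsCompact {z : Fin N → ℝ | ∑ i, z i ^ 2 ≤ r ^ 2} := by
    refine (isCompact_closedBall (0 : Fin N → ℝ) |r|).of_isClosed_subset
      (isClosed_setOf_sum_sq_le N r) fun z hz => ?_
    rw [mem_closedBall_zero_iff, pi_norm_le_iff_of_nonneg (abs_nonneg r)]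
    intro i
    exact sq_le_sq.1 ((Finset.single_le_sum (f := fun i => z i ^ 2) (fun _ _ => sq_nonneg _)
      (Finset.mem_univ i)).trans hz)
  exact ((continuous_vand_two N).continuousOn.integrableOn_compact hK).integrable_indicator
    hK.measurableSet

lemma vand_two_smul (N : ℕ) (s : ℝ) (x : Fin N → ℝ) :
    vand 2 N (s • x) = s ^ (N * (N - 1)) * vand 2 N x := by
  have h : Matrix.vandermonde (s • x)
      = Matrix.of fun i j : Fin N => s ^ (j : ℕ) * Matrix.vandermonde x i j := by
    ext i j
    simp [Matrix.vandermonde_apply, mul_pow]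
  rw [vand_two_eq_det_vandermonde_sq, vand_two_eq_det_vandermonde_sq, h,
    Matrix.det_mul_row (fun j : Fin N => s ^ (j : ℕ)), mul_pow, Finset.prod_pow_eq_pow_sum,
    Fin.sum_univ_eq_sum_range (fun k => k), ← pow_mul, Finset.sum_range_id_mul_two]

lemma btWeight_smul (N : ℕ) {s : ℝ} (hs : 0 < s) (r : ℝ) (x : Fin N → ℝ) :
    btWeight N (s * r) (s • x) = s ^ (N * (N - 1)) * btWeight N r x := by
  have h : s • x ∈ {z : Fin N → ℝ | ∑ i, z i ^ 2 ≤ (s * r) ^ 2}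
      ↔ x ∈ {z : Fin N → ℝ | ∑ i, z i ^ 2 ≤ r ^ 2} := by
    simp only [Set.mem_ofPred_eq, Pi.smul_apply, smul_eq_mul, mul_pow, ← Finset.mul_sum]
    exact mul_le_mul_iff_right₀ (by positivity)
  unfold btWeight
  by_cases hx : x ∈ {z : Fin N → ℝ | ∑ i, z i ^ 2 ≤ r ^ 2}
  · rw [Set.indicator_of_mem (h.2 hx), Set.indicator_of_mem hx, vand_two_smul]
  · rw [Set.indicator_of_notMem (mt h.1 hx), Set.indicator_of_notMem hx, mul_zero]

lemma integral_mul_btWeight_mul (N : ℕ) {s : ℝ} (hs : 0 < s) (r : ℝ) (F : (Fin N → ℝ) → ℝ) :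
    ∫ x, F x * btWeight N (s * r) x = s ^ (N ^ 2) * ∫ y, F (s • y) * btWeight N r y := by
  have h := Measure.integral_comp_smul volume (fun x => F x * btWeight N (s * r) x) s
  rw [Module.finrank_fin_fun, abs_of_pos (by positivity), smul_eq_mul, eq_comm,
    inv_mul_eq_iff_eq_mul₀ (by positivity)] at h
  rw [h, ← integral_const_mul, ← integral_const_mul]
  refine integral_congr_ae (Eventually.of_forall fun y => ?_)
  have e : N ^ 2 = N + N * (N - 1) := by
    rcases N with _ | k
    · rfl
    · simp only [Nat.add_sub_cancel]
      ring
  simp only [btWeight_smul N hs r y, e, pow_add]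
  ring

lemma hasDerivAt_neg_exp_neg_sq_half (b s : ℝ) :
    HasDerivAt (fun s => -rexp (-(b * s) ^ 2 / 2)) (b ^ 2 * s * rexp (-(b * s) ^ 2 / 2)) s := by
  have h : HasDerivAt (fun s : ℝ => -(b * s) ^ 2 / 2) (-(b ^ 2 * s)) s := by
    refine ((((hasDerivAt_id' s).const_mul b).pow 2).fun_neg.div_const 2).congr_deriv ?_
    norm_num
    ring
  refine h.exp.fun_neg.congr_deriv ?_
  ring

lemma tendsto_neg_exp_neg_sq_half {b : ℝ} (hb : 0 < b) :
    Tendsto (fun s => -rexp (-(b * s) ^ 2 / 2)) atTop (𝓝 0) := by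
  rw [← neg_zero]
  refine (Real.tendsto_exp_atBot.comp ?_).neg
  have h : Tendsto (fun s : ℝ => (b * s) ^ 2) atTop atTop :=
    (tendsto_pow_atTop two_ne_zero).comp (tendsto_id.const_mul_atTop hb)
  exact (tendsto_neg_atTop_atBot.comp h).atBot_div_const two_pos

lemma integrableOn_mul_exp_neg_sq_half {b : ℝ} (hb : 0 < b) :
    IntegrableOn (fun s => b ^ 2 * s * rexp (-(b * s) ^ 2 / 2)) (Set.Ioi 0) :=
  integrableOn_Ioi_deriv_of_nonneg' (fun s _ => hasDerivAt_neg_exp_neg_sq_half b s)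
    (fun _ hs => mul_nonneg (mul_nonneg (sq_nonneg b) (Set.mem_Ioi.1 hs).le) (exp_pos _).le)
    (tendsto_neg_exp_neg_sq_half hb)

/-- The Gaussian as a mixture of indicators of balls. -/
lemma integral_indicator_mul_exp_neg_sq_half {b Q : ℝ} (hb : 0 < b) (hQ : 0 ≤ Q) :
    ∫ s in Set.Ioi (0 : ℝ), (if Q ≤ (s * b) ^ 2 then b ^ 2 * s * rexp (-(b * s) ^ 2 / 2) else 0)
      = rexp (-Q / 2) := by
  have h0 : 0 ≤ √Q / b := by positivity
  have hset : ∀ s : ℝ, s ∈ Set.Ioi (0 : ℝ) → (Q ≤ (s * b) ^ 2 ↔ √Q / b ≤ s) := fun s hs => by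
    have hs : 0 < s := hs
    rw [div_le_iff₀ hb, Real.sqrt_le_left (by positivity)]
  have h1 : ∫ s in Set.Ioi (0 : ℝ),
        (if Q ≤ (s * b) ^ 2 then b ^ 2 * s * rexp (-(b * s) ^ 2 / 2) else 0)
      = ∫ s in Set.Ioi (0 : ℝ), Set.indicator (Set.Ici (√Q / b))
        (fun s => b ^ 2 * s * rexp (-(b * s) ^ 2 / 2)) s := by
    refine setIntegral_congr_fun measurableSet_Ioi fun s hs => ?_
    simp only [Set.indicator_apply, Set.mem_Ici, hset s hs]
  have h2 : (Set.Ioi (0 : ℝ) ∩ Set.Ici (√Q / b) : Set ℝ) =ᵐ[volume] Set.Ioi (√Q / b) := by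
    have : (Set.Ioi (0 : ℝ) ∩ Set.Ioi (√Q / b) : Set ℝ) = Set.Ioi (√Q / b) := by
      rw [Set.Ioi_inter_Ioi, max_eq_right h0]
    rw [← this]
    exact (ae_eq_refl _).inter Ioi_ae_eq_Ici.symm
  rw [h1, setIntegral_indicator measurableSet_Ici, setIntegral_congr_set h2,
    integral_Ioi_of_hasDerivAt_of_tendsto' (fun s _ => hasDerivAt_neg_exp_neg_sq_half b s)
      ((integrableOn_mul_exp_neg_sq_half hb).mono_set (Set.Ioi_subset_Ioi h0))
      (tendsto_neg_exp_neg_sq_half hb), zero_sub, neg_neg, mul_div_cancel₀ _ hb.ne',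
      Real.sq_sqrt hQ]

/-- The unnormalized density of the radius mixing bounded trace ensembles into the Gaussian
ensemble. -/
noncomputable def dilWeight (N : ℕ) (s : ℝ) : ℝ :=
  (N : ℝ) ^ 2 * s * rexp (-(N * s) ^ 2 / 2) * s ^ (N ^ 2)

lemma integral_mul_gueWeight_eq {N : ℕ} (hN : 0 < N) {F : (Fin N → ℝ) → ℝ} (hF : Measurable F)
    {C : ℝ} (hC : ∀ x, |F x| ≤ C) :
    ∫ x, F x * gueWeight N x
      = ∫ s in Set.Ioi (0 : ℝ), dilWeight N s * ∫ y, F (s • y) * btWeight N N y := by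
  have hb : (0 : ℝ) < N := Nat.cast_pos.2 hN
  set w : ℝ → ℝ := fun s => (N : ℝ) ^ 2 * s * rexp (-(N * s) ^ 2 / 2) with hw
  set G : (Fin N → ℝ) → ℝ → ℝ := fun x s => F x * vand 2 N x *
    (if ∑ i, x i ^ 2 ≤ (s * N) ^ 2 then w s else 0) with hG
  have hQ : ∀ x : Fin N → ℝ, 0 ≤ ∑ i, x i ^ 2 := fun x =>
    Finset.sum_nonneg fun _ _ => sq_nonneg _
  have hGs : ∀ x, ∫ s in Set.Ioi (0 : ℝ), G x s = F x * gueWeight N x := fun x => by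
    rw [hG]
    simp only
    rw [integral_const_mul, integral_indicator_mul_exp_neg_sq_half hb (hQ x), gueWeight, mul_assoc]
  have hmeasIf : Measurable fun p : (Fin N → ℝ) × ℝ =>
      (if ∑ i, p.1 i ^ 2 ≤ (p.2 * N) ^ 2 then w p.2 else 0) := by
    refine Measurable.ite ?_ ?_ measurable_const
    · exact measurableSet_le (by fun_prop) (by fun_prop)
    · simp only [hw]
      fun_prop
  have hmeas : Measurable (Function.uncurry G) :=
    ((hF.comp measurable_fst).mul ((continuous_vand_two N).measurable.comp measurable_fst)).mul
      hmeasIf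
  have hInt : Integrable (Function.uncurry G)
      ((volume : Measure (Fin N → ℝ)).prod (volume.restrict (Set.Ioi (0 : ℝ)))) := by
    rw [integrable_prod_iff hmeas.aestronglyMeasurable]
    constructor
    · refine Eventually.of_forall fun x => ?_
      refine Integrable.const_mul (c := F x * vand 2 N x) ?_
      refine Integrable.mono (integrableOn_mul_exp_neg_sq_half hb)
        (hmeasIf.comp (measurable_const.prodMk measurable_id)).aestronglyMeasurable
        (Eventually.of_forall fun s => ?_)
      simp only
      split_ifs
      · exact le_rfl
      · rw [norm_zero]
        exact norm_nonneg _
    · have : ∀ x, ∫ s in Set.Ioi (0 : ℝ), ‖Function.uncurry G (x, s)‖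
          = |F x| * gueWeight N x := fun x => by
        rw [gueWeight, ← integral_indicator_mul_exp_neg_sq_half hb (hQ x), ← mul_assoc,
          ← integral_const_mul]
        refine setIntegral_congr_fun measurableSet_Ioi fun s hs => ?_
        simp only [Function.uncurry, hG, norm_mul, Real.norm_eq_abs,
          abs_of_nonneg (vand_nonneg 2 N x)]
        congr 1
        split_ifs
        · exact abs_of_nonneg
            (mul_nonneg (mul_nonneg (sq_nonneg _) (Set.mem_Ioi.1 hs).le) (exp_pos _).le)
        · simp
      simp_rw [this]
      exact (integrable_gueWeight N).bdd_mul (c := C) hF.abs.aestronglyMeasurable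
        (Eventually.of_forall fun x => by simpa using hC x)
  calc ∫ x, F x * gueWeight N x = ∫ x, ∫ s in Set.Ioi (0 : ℝ), G x s := by simp_rw [hGs]
    _ = ∫ s in Set.Ioi (0 : ℝ), ∫ x, G x s := integral_integral_swap hInt
    _ = _ := by
      refine setIntegral_congr_fun measurableSet_Ioi fun s hs => ?_
      have hs : 0 < s := hs
      have e : ∀ x, G x s = w s * (F x * btWeight N (s * N) x) := fun x => by
        simp only [hG, btWeight, Set.indicator_apply, Set.mem_ofPred_eq]
        split_ifs <;> ring
      simp only [e]
      rw [integral_const_mul, integral_mul_btWeight_mul N hs, dilWeight]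
      ring

lemma dilWeight_nonneg (N : ℕ) {s : ℝ} (hs : 0 < s) : 0 ≤ dilWeight N s := by
  unfold dilWeight
  positivity

lemma integral_gueWeight_eq_mul {N : ℕ} (hN : 0 < N) :
    ∫ x, gueWeight N x = (∫ s in Set.Ioi (0 : ℝ), dilWeight N s) * ∫ y, btWeight N N y := by
  have h := integral_mul_gueWeight_eq hN (F := fun _ => 1) measurable_const (C := 1) (by simp)
  simp only [one_mul] at h
  rw [h, integral_mul_const]

lemma integral_dilWeight_pos {N : ℕ} (hN : 0 < N) : 0 < ∫ s in Set.Ioi (0 : ℝ), dilWeight N s := by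
  refine (setIntegral_nonneg measurableSet_Ioi fun s hs => dilWeight_nonneg N hs).lt_of_ne'
    fun h => ?_
  have := integral_gueWeight_pos N
  rw [integral_gueWeight_eq_mul hN, h, zero_mul] at this
  exact this.false

lemma integral_btWeight_pos {N : ℕ} (hN : 0 < N) : 0 < ∫ y, btWeight N N y := by
  refine (integral_nonneg fun y => btWeight_nonneg N N y).lt_of_ne' fun h => ?_
  have := integral_gueWeight_pos N
  rw [integral_gueWeight_eq_mul hN, h, mul_zero] at this
  exact this.false

lemma integrableOn_dilWeight {N : ℕ} (hN : 0 < N) : IntegrableOn (dilWeight N) (Set.Ioi 0) :=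
  not_imp_comm.1 integral_undef (integral_dilWeight_pos hN).ne'

lemma dilWeight_eq (N : ℕ) {s : ℝ} (hs : 0 < s) :
    dilWeight N s = (N : ℝ) ^ 2 * s * rexp ((N : ℝ) ^ 2 * (log s - s ^ 2 / 2)) := by
  have h : s ^ (N ^ 2) = rexp ((N : ℝ) ^ 2 * log s) := by
    rw [← Nat.cast_pow, Real.exp_nat_mul, Real.exp_log hs]
  rw [dilWeight, h, mul_assoc, ← Real.exp_add]
  congr 2
  ring

lemma dilWeight_le (N : ℕ) {s : ℝ} (hs : 0 < s) :
    dilWeight N s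
      ≤ (N : ℝ) ^ 2 * rexp (-(N : ℝ) ^ 2 / 2) * (s * rexp (-((N : ℝ) ^ 2 * (s - 1) ^ 2 / 2))) := by
  rw [dilWeight_eq N hs]
  have h : (N : ℝ) ^ 2 * (log s - s ^ 2 / 2) ≤ -(N : ℝ) ^ 2 / 2 + -((N : ℝ) ^ 2 * (s - 1) ^ 2 / 2) := by
    have := mul_le_mul_of_nonneg_left (Real.log_le_sub_one_of_pos hs) (sq_nonneg (N : ℝ))
    linarith
  calc (N : ℝ) ^ 2 * s * rexp ((N : ℝ) ^ 2 * (log s - s ^ 2 / 2))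
      ≤ (N : ℝ) ^ 2 * s * rexp (-(N : ℝ) ^ 2 / 2 + -((N : ℝ) ^ 2 * (s - 1) ^ 2 / 2)) := by gcongr
    _ = _ := by
      rw [Real.exp_add]
      ring

lemma le_dilWeight {N : ℕ} (hN : 0 < N) {s : ℝ} (h1 : 1 ≤ s) (h2 : s ≤ 1 + 1 / N) :
    (N : ℝ) ^ 2 * rexp (-(N : ℝ) ^ 2 / 2) * rexp (-(3 / 2)) ≤ dilWeight N s := by
  have hb : (0 : ℝ) < N := Nat.cast_pos.2 hN
  have hs : 0 < s := by linarith
  rw [dilWeight_eq N hs]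
  have hlog : (s - 1) - (s - 1) ^ 2 ≤ log s := by
    refine le_trans ?_ (Real.one_sub_inv_le_log_of_pos hs)
    have : 1 - s⁻¹ - ((s - 1) - (s - 1) ^ 2) = (s - 1) ^ 3 / s := by
      field_simp
      ring
    have h3 : 0 ≤ (s - 1) ^ 3 / s := div_nonneg (pow_nonneg (by linarith) 3) hs.le
    linarith
  have hu : (N : ℝ) ^ 2 * (s - 1) ^ 2 ≤ 1 := by
    rw [← mul_pow]
    refine pow_le_one₀ (mul_nonneg hb.le (by linarith)) ?_
    calc (N : ℝ) * (s - 1) ≤ N * (1 / N) := by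
          gcongr
          linarith
      _ = 1 := by field_simp
  have h : -(N : ℝ) ^ 2 / 2 + -(3 / 2) ≤ (N : ℝ) ^ 2 * (log s - s ^ 2 / 2) := by
    have := mul_le_mul_of_nonneg_left hlog (sq_nonneg (N : ℝ))
    linarith
  calc (N : ℝ) ^ 2 * rexp (-(N : ℝ) ^ 2 / 2) * rexp (-(3 / 2))
      = (N : ℝ) ^ 2 * 1 * rexp (-(N : ℝ) ^ 2 / 2 + -(3 / 2)) := by
        rw [Real.exp_add]
        ring
    _ ≤ _ := by gcongr

lemma le_integral_dilWeight {N : ℕ} (hN : 0 < N) :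
    (N : ℝ) * rexp (-(N : ℝ) ^ 2 / 2) * rexp (-(3 / 2))
      ≤ ∫ s in Set.Ioi (0 : ℝ), dilWeight N s := by
  have hb : (0 : ℝ) < N := Nat.cast_pos.2 hN
  have hsub : Set.Icc (1 : ℝ) (1 + 1 / N) ⊆ Set.Ioi 0 := fun s hs => zero_lt_one.trans_le hs.1
  calc (N : ℝ) * rexp (-(N : ℝ) ^ 2 / 2) * rexp (-(3 / 2))
      = ∫ _ in Set.Icc (1 : ℝ) (1 + 1 / N),
          (N : ℝ) ^ 2 * rexp (-(N : ℝ) ^ 2 / 2) * rexp (-(3 / 2)) := by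
        rw [setIntegral_const, Real.volume_real_Icc_of_le (by simp)]
        simp only [add_sub_cancel_left, smul_eq_mul]
        field_simp
    _ ≤ ∫ s in Set.Icc (1 : ℝ) (1 + 1 / N), dilWeight N s :=
        setIntegral_mono_on (integrableOn_const (by simp))
          ((integrableOn_dilWeight hN).mono_set hsub) measurableSet_Icc
          fun s hs => le_dilWeight hN hs.1 hs.2
    _ ≤ _ := setIntegral_mono_set (integrableOn_dilWeight hN)
        (ae_restrict_of_forall_mem measurableSet_Ioi fun s hs => dilWeight_nonneg N hs)
        (Eventually.of_forall hsub)

lemma integrable_mul_exp_neg_sub_one_sq :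
    Integrable fun s : ℝ => |s| * rexp (-((s - 1) ^ 2 / 4)) := by
  have h1 : Integrable fun s : ℝ => s * rexp (-(1 / 4) * s ^ 2) :=
    integrable_mul_exp_neg_mul_sq (by norm_num)
  have h2 : Integrable fun s : ℝ => rexp (-(1 / 4) * s ^ 2) :=
    integrable_exp_neg_mul_sq (by norm_num)
  refine (((h1.add h2).comp_sub_right 1).abs).congr (Eventually.of_forall fun s => ?_)
  simp only [Pi.add_apply]
  rw [← add_one_mul, abs_mul, abs_of_pos (exp_pos _)]
  congr 2 <;> ring

/-- The mixing radius concentrates at one. -/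
lemma exists_setIntegral_dilWeight_le : ∃ A : ℝ, ∀ N : ℕ, 0 < N → ∀ d : ℝ, 0 ≤ d →
    ∫ s in {s : ℝ | d < |s - 1|} ∩ Set.Ioi 0, dilWeight N s
      ≤ A * N * rexp (-((N : ℝ) ^ 2 * d ^ 2 / 4)) * ∫ s in Set.Ioi (0 : ℝ), dilWeight N s := by
  set A := ∫ s : ℝ, |s| * rexp (-((s - 1) ^ 2 / 4)) with hA
  have hA0 : 0 ≤ A := integral_nonneg fun s => by positivity
  refine ⟨A * rexp (3 / 2), fun N hN d hd => ?_⟩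
  have hN1 : (1 : ℝ) ≤ N := by exact_mod_cast hN
  have hmeas : MeasurableSet ({s : ℝ | d < |s - 1|} ∩ Set.Ioi 0) :=
    (measurableSet_lt measurable_const (by fun_prop)).inter measurableSet_Ioi
  set c := (N : ℝ) ^ 2 * rexp (-(N : ℝ) ^ 2 / 2) * rexp (-((N : ℝ) ^ 2 * d ^ 2 / 4)) with hc
  have hc0 : 0 ≤ c := by positivity
  calc ∫ s in {s : ℝ | d < |s - 1|} ∩ Set.Ioi 0, dilWeight N s
      ≤ ∫ s in {s : ℝ | d < |s - 1|} ∩ Set.Ioi 0, c * (|s| * rexp (-((s - 1) ^ 2 / 4))) := by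
        refine setIntegral_mono_on ((integrableOn_dilWeight hN).mono_set Set.inter_subset_right)
          (integrable_mul_exp_neg_sub_one_sq.const_mul c).integrableOn hmeas fun s hs => ?_
        have hs0 : 0 < s := hs.2
        have hds : d ^ 2 ≤ (s - 1) ^ 2 := by
          rw [← sq_abs (s - 1)]
          have : d < |s - 1| := hs.1
          gcongr
        refine (dilWeight_le N hs0).trans ?_
        rw [hc, abs_of_pos hs0]
        have hexp : rexp (-((N : ℝ) ^ 2 * (s - 1) ^ 2 / 2))
            ≤ rexp (-((N : ℝ) ^ 2 * d ^ 2 / 4)) * rexp (-((s - 1) ^ 2 / 4)) := by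
          rw [← Real.exp_add]
          gcongr
          have h1 := mul_le_mul_of_nonneg_left hds (sq_nonneg (N : ℝ))
          have h2 : 1 * (s - 1) ^ 2 ≤ (N : ℝ) ^ 2 * (s - 1) ^ 2 := by
            gcongr
            exact one_le_pow₀ hN1
          linarith
        calc _ ≤ (N : ℝ) ^ 2 * rexp (-(N : ℝ) ^ 2 / 2) *
              (s * (rexp (-((N : ℝ) ^ 2 * d ^ 2 / 4)) * rexp (-((s - 1) ^ 2 / 4)))) := by gcongr
          _ = _ := by ring
    _ ≤ ∫ s, c * (|s| * rexp (-((s - 1) ^ 2 / 4))) :=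
        setIntegral_le_integral (integrable_mul_exp_neg_sub_one_sq.const_mul c)
          (Eventually.of_forall fun s => by positivity)
    _ = A * rexp (3 / 2) * N * rexp (-((N : ℝ) ^ 2 * d ^ 2 / 4)) *
          (N * rexp (-(N : ℝ) ^ 2 / 2) * rexp (-(3 / 2))) := by
        rw [integral_const_mul, ← hA, hc, Real.exp_neg (3 / 2)]
        field_simp
    _ ≤ _ := by
        gcongr
        exact le_integral_dilWeight hN

lemma integral_comp_add_mul {n : ℕ} (g : (Fin n → ℝ) → ℝ) {c : ℝ} (hc : 0 < c) (b : ℝ) :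
    c ^ n * ∫ t : Fin n → ℝ, g (fun i => b + c * t i) = ∫ x, g x := by
  have h := Measure.integral_comp_smul volume (fun x : Fin n → ℝ => g ((fun _ => b) + x)) c
  rw [Module.finrank_fin_fun, abs_of_pos (by positivity), smul_eq_mul, eq_comm,
    inv_mul_eq_iff_eq_mul₀ (by positivity), integral_add_left_eq_self] at h
  exact h.symm

lemma factorial_div_factorial_le_pow {n N : ℕ} (h : n ≤ N) :
    (N.factorial : ℝ) / (N - n).factorial ≤ (N : ℝ) ^ n := by
  rw [div_le_iff₀ (by positivity), mul_comm]
  have := Nat.factorial_mul_descFactorial h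
  rw [← this]
  push_cast
  gcongr
  exact_mod_cast Nat.descFactorial_le_pow N n

/-- The law of the radius mixing bounded trace ensembles into the Gaussian ensemble. -/
noncomputable def dilMeasure (N : ℕ) : Measure ℝ :=
  (volume.restrict (Set.Ioi 0)).withDensity fun s =>
    ENNReal.ofReal ((∫ s in Set.Ioi (0 : ℝ), dilWeight N s)⁻¹ * dilWeight N s)

lemma measurable_dilWeight (N : ℕ) : Measurable (dilWeight N) := by
  unfold dilWeight
  fun_prop

lemma integral_dilMeasure {N : ℕ} (hN : 0 < N) (g : ℝ → ℝ) :
    ∫ s, g s ∂(dilMeasure N) = (∫ s in Set.Ioi (0 : ℝ), dilWeight N s)⁻¹ *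
      ∫ s in Set.Ioi (0 : ℝ), dilWeight N s * g s := by
  rw [dilMeasure, integral_withDensity_eq_integral_toReal_smul
    ((measurable_dilWeight N).const_mul _).ennreal_ofReal (Eventually.of_forall fun _ => by simp),
    ← integral_const_mul]
  refine setIntegral_congr_fun measurableSet_Ioi fun s hs => ?_
  simp only [smul_eq_mul]
  rw [ENNReal.toReal_ofReal (mul_nonneg (inv_nonneg.2 (integral_dilWeight_pos hN).le)
    (dilWeight_nonneg N hs)), mul_assoc]

lemma isProbabilityMeasure_dilMeasure {N : ℕ} (hN : 0 < N) :
    IsProbabilityMeasure (dilMeasure N) := by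
  refine ⟨?_⟩
  have hW := integral_dilWeight_pos hN
  rw [dilMeasure, withDensity_apply _ MeasurableSet.univ, Measure.restrict_univ,
    ← ofReal_integral_eq_lintegral_ofReal ((integrableOn_dilWeight hN).const_mul _)
      (ae_restrict_of_forall_mem measurableSet_Ioi fun s hs =>
        mul_nonneg (inv_nonneg.2 hW.le) (dilWeight_nonneg N hs)),
    integral_const_mul, inv_mul_cancel₀ hW.ne', ENNReal.ofReal_one]

lemma exists_dilMeasure_real_le : ∃ A : ℝ, ∀ N : ℕ, 0 < N → ∀ d : ℝ, 0 ≤ d →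
    (dilMeasure N).real {s | d < |s - 1|} ≤ A * N * rexp (-((N : ℝ) ^ 2 * d ^ 2 / 4)) := by
  obtain ⟨A, hA⟩ := exists_setIntegral_dilWeight_le
  refine ⟨A, fun N hN d hd => ?_⟩
  have hW := integral_dilWeight_pos hN
  have hmeas : MeasurableSet {s : ℝ | d < |s - 1|} :=
    measurableSet_lt measurable_const (by fun_prop)
  rw [← integral_indicator_one hmeas, integral_dilMeasure hN, inv_mul_le_iff₀ hW]
  refine le_trans (le_of_eq ?_) ((hA N hN d hd).trans_eq (mul_comm _ _))
  rw [Set.inter_comm, ← setIntegral_indicator hmeas]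
  refine integral_congr_ae (Eventually.of_forall fun s => ?_)
  simp only [Set.indicator_apply]
  split_ifs <;> simp

/-- The map from the eigenvalues in `ℝ^N` to edge coordinates of the first `n` of them. -/
noncomputable def edgeChart {n N : ℕ} (h : n ≤ N) (y : Fin N → ℝ) : Fin n → ℝ := fun a =>
  (N : ℝ) ^ (1 / 6 : ℝ) * (y (Fin.castLE h a) - 2 * ((N : ℝ) ^ (1 / 6 : ℝ)) ^ 3)

lemma continuous_edgeChart {n N : ℕ} (h : n ≤ N) : Continuous (edgeChart h) := by
  unfold edgeChart
  fun_prop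

lemma edgeChart_smul {n N : ℕ} (h : n ≤ N) (s : ℝ) (y : Fin N → ℝ) :
    edgeChart h (s • y) = edgeDilate n (2 * ((N : ℝ) ^ (1 / 6 : ℝ)) ^ 4) s (edgeChart h y) := by
  ext a
  simp only [edgeChart, edgeDilate, Pi.smul_apply, smul_eq_mul]
  ring

/-- The `n`-point correlation measure of the bounded trace ensemble of strength `N`, in edge
coordinates. -/
noncomputable def btEdgeMeasure {n N : ℕ} (h : n ≤ N) : Measure (Fin n → ℝ) :=
  ENNReal.ofReal (N.factorial / (N - n).factorial * (∫ y, btWeight N N y)⁻¹) •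
    (volume.withDensity fun y => ENNReal.ofReal (btWeight N N y)).map (edgeChart h)

lemma integral_btEdgeMeasure {n N : ℕ} (h : n ≤ N) {f : (Fin n → ℝ) → ℝ}
    (hf : Measurable f) : ∫ t, f t ∂(btEdgeMeasure h) =
      N.factorial / (N - n).factorial * (∫ y, btWeight N N y)⁻¹ *
        ∫ y, f (edgeChart h y) * btWeight N N y := by
  rw [btEdgeMeasure, integral_smul_measure, integral_map
    (continuous_edgeChart h).measurable.aemeasurable hf.aestronglyMeasurable,
    integral_withDensity_eq_integral_toReal_smul (measurable_btWeight N N).ennreal_ofReal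
    (Eventually.of_forall fun _ => by simp), smul_eq_mul, ENNReal.toReal_ofReal
    (mul_nonneg (by positivity) (inv_nonneg.2 (integral_nonneg fun y => btWeight_nonneg N N y)))]
  congr 1
  refine integral_congr_ae (Eventually.of_forall fun y => ?_)
  simp only [smul_eq_mul]
  rw [ENNReal.toReal_ofReal (btWeight_nonneg N N y), mul_comm]

lemma isFiniteMeasure_btEdgeMeasure {n N : ℕ} (h : n ≤ N) : IsFiniteMeasure (btEdgeMeasure h) := by
  have : IsFiniteMeasure (volume.withDensity fun y => ENNReal.ofReal (btWeight N N y)) :=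
    isFiniteMeasure_withDensity_ofReal (integrable_btWeight N N).2
  unfold btEdgeMeasure
  exact Measure.smul_finite _ ENNReal.ofReal_ne_top

lemma btEdgeMeasure_real_univ_le {n N : ℕ} (h : n ≤ N) (hN : 0 < N) :
    (btEdgeMeasure h).real Set.univ ≤ (N : ℝ) ^ n := by
  have := integral_btEdgeMeasure h (f := fun _ => 1) measurable_const
  rw [integral_const, smul_eq_mul, mul_one] at this
  simp only [one_mul] at this
  rw [this, mul_assoc, inv_mul_cancel₀ (integral_btWeight_pos hN).ne', mul_one]
  exact factorial_div_factorial_le_pow h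

lemma det_edgeKernel (N : ℕ) {n : ℕ} (t : Fin n → ℝ) :
    (Matrix.of fun j k => edgeKernel N (t j) (t k)).det = ((N : ℝ) ^ (1 / 6 : ℝ))⁻¹ ^ n *
      (Matrix.of fun j k => hermKernel N
        (2 * ((N : ℝ) ^ (1 / 6 : ℝ)) ^ 3 + ((N : ℝ) ^ (1 / 6 : ℝ))⁻¹ * t j)
        (2 * ((N : ℝ) ^ (1 / 6 : ℝ)) ^ 3 + ((N : ℝ) ^ (1 / 6 : ℝ))⁻¹ * t k)).det := by
  have := Matrix.det_smul (Matrix.of fun j k => hermKernel N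
        (2 * ((N : ℝ) ^ (1 / 6 : ℝ)) ^ 3 + ((N : ℝ) ^ (1 / 6 : ℝ))⁻¹ * t j)
        (2 * ((N : ℝ) ^ (1 / 6 : ℝ)) ^ 3 + ((N : ℝ) ^ (1 / 6 : ℝ))⁻¹ * t k))
        ((N : ℝ) ^ (1 / 6 : ℝ))⁻¹
  rw [Fintype.card_fin] at this
  rw [← this]
  congr 1
  ext j k
  simp only [Matrix.of_apply, Matrix.smul_apply, smul_eq_mul, edgeKernel, div_eq_inv_mul]

lemma integral_integral_edgeDilate {n N : ℕ} (h : n ≤ N) (hN : 0 < N) {f : (Fin n → ℝ) → ℝ}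
    (hf : Continuous f) (hsupp : HasCompactSupport f) :
    ∫ s, ∫ t, f (edgeDilate n (2 * ((N : ℝ) ^ (1 / 6 : ℝ)) ^ 4) s t) ∂(btEdgeMeasure h)
        ∂(dilMeasure N) =
      ∫ t, f t * (Matrix.of fun j k => edgeKernel N (t j) (t k)).det := by
  obtain ⟨C, -, hC⟩ := exists_abs_le_of_hasCompactSupport hf hsupp
  set q := (N : ℝ) ^ (1 / 6 : ℝ) with hq
  have hq0 : 0 < q := Real.rpow_pos_of_pos (Nat.cast_pos.2 hN) _
  have hW := integral_dilWeight_pos hN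
  have hJ := integral_btWeight_pos hN
  have hcont : ∀ s, Continuous fun t => f (edgeDilate n (2 * q ^ 4) s t) := fun s =>
    hf.comp ((continuous_edgeDilate n _).comp (continuous_const.prodMk continuous_id))
  have hmix := integral_mul_gueWeight_eq hN (hf.comp (continuous_edgeChart h)).measurable
    (C := C) (fun x => hC _)
  simp only [Function.comp_apply, edgeChart_smul h] at hmix
  have hdet := integral_castLE_mul_gueWeight h
    (F := fun x => f fun a => q * (x a - 2 * q ^ 3)) (hf.comp (by fun_prop)).measurable
    (C := C) (fun x => hC _)
  have hcov := integral_comp_add_mul (fun x : Fin n → ℝ => f (fun a => q * (x a - 2 * q ^ 3)) *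
    (Matrix.of fun i j => hermKernel N (x i) (x j)).det) (inv_pos.2 hq0) (2 * q ^ 3)
  have hrhs : ∫ t, f t * (Matrix.of fun j k => edgeKernel N (t j) (t k)).det =
      ∫ x : Fin n → ℝ, f (fun a => q * (x a - 2 * q ^ 3)) *
        (Matrix.of fun i j => hermKernel N (x i) (x j)).det := by
    rw [← hcov, ← integral_const_mul]
    refine integral_congr_ae (Eventually.of_forall fun t => ?_)
    simp only [add_sub_cancel_left, mul_inv_cancel_left₀ hq0.ne']
    rw [det_edgeKernel]
    ring
  have hgue : ∫ x, f (edgeChart h x) * gueWeight N x = ∫ x : Fin N → ℝ,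
      (fun x : Fin n → ℝ => f fun a => q * (x a - 2 * q ^ 3)) (fun a => x (Fin.castLE h a)) *
        gueWeight N x := rfl
  rw [hrhs, integral_dilMeasure hN]
  have hlhs : ∫ s in Set.Ioi (0 : ℝ), dilWeight N s *
        ∫ t, f (edgeDilate n (2 * q ^ 4) s t) ∂(btEdgeMeasure h) =
      N.factorial / (N - n).factorial * (∫ y, btWeight N N y)⁻¹ *
        ∫ x, f (edgeChart h x) * gueWeight N x := by
    rw [hmix, ← integral_const_mul]
    refine integral_congr_ae (Eventually.of_forall fun s => ?_)
    simp only
    rw [integral_btEdgeMeasure h (hcont s).measurable]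
    ring
  rw [hlhs, hgue, mul_right_comm _ (_⁻¹), hdet, integral_gueWeight_eq_mul hN]
  generalize (∫ x : Fin n → ℝ, f (fun a => q * (x a - 2 * q ^ 3)) *
        (Matrix.of fun i j => hermKernel N (x i) (x j)).det) = I
  field_simp

lemma integral_mul_integral_combine {n N : ℕ} (h : n ≤ N) (r : ℝ) {F : (Fin n → ℝ) → ℝ}
    (hF : Measurable F) {C : ℝ} (hC : ∀ x, |F x| ≤ C) :
    ∫ x, F x * ∫ y, btWeight N r (combine N n x y) =
      ∫ z : Fin N → ℝ, F (fun a => z (Fin.castLE h a)) * btWeight N r z := by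
  have hmp := (measurePreserving_finSplit h).comp
    (volume_measurePreserving_sumPiEquivProdPi_symm (fun _ : Fin n ⊕ Fin (N - n) => ℝ))
  have hcomb : ∀ p : (Fin n → ℝ) × (Fin (N - n) → ℝ),
      ((MeasurableEquiv.sumPiEquivProdPi (fun _ : Fin n ⊕ Fin (N - n) => ℝ)).symm.trans
        (MeasurableEquiv.piCongrLeft (fun _ : Fin N => ℝ) (finSplit h))) p
      = combine N n p.1 p.2 := by
    intro p
    funext i
    obtain ⟨j, rfl⟩ := (finSplit h).surjective i
    rw [combine_finSplit, MeasurableEquiv.trans_apply, piCongrLeft_finSplit_apply]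
    rcases j with a | b <;> rfl
  have hInt : Integrable fun z : Fin N → ℝ => F (fun a => z (Fin.castLE h a)) * btWeight N r z :=
    (integrable_btWeight N r).bdd_mul (c := C)
      (hF.comp (measurable_pi_lambda _ fun a => measurable_pi_apply _)).aestronglyMeasurable
      (Eventually.of_forall fun x => hC _)
  have hmp' : MeasurePreserving
      ((MeasurableEquiv.sumPiEquivProdPi (fun _ : Fin n ⊕ Fin (N - n) => ℝ)).symm.trans
        (MeasurableEquiv.piCongrLeft (fun _ : Fin N => ℝ) (finSplit h))) volume volume := hmp
  have hInt' := (hmp'.integrable_comp_emb (MeasurableEquiv.measurableEmbedding _)).2 hInt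
  rw [← hmp'.integral_comp']
  refine Eq.trans ?_ (integral_prod _ hInt').symm
  refine integral_congr_ae (Eventually.of_forall fun x => ?_)
  simp only [Function.comp_apply, hcomb]
  rw [← integral_const_mul]
  refine integral_congr_ae (Eventually.of_forall fun y => ?_)
  simp only
  congr 2
  funext a
  rw [← finSplit_inl h, combine_finSplit]
  rfl

lemma integral_mul_Rbt {n N : ℕ} (h : n ≤ N) (hN : 0 < N) {f : (Fin n → ℝ) → ℝ}
    (hf : Continuous f) (hsupp : HasCompactSupport f) :
    ∫ t : Fin n → ℝ, f t * (1 / (2 * (N : ℝ) ^ ((2 : ℝ) / 3))) ^ n *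
        Rbt 2 n N (√N / 2) (fun i => 1 + t i / (2 * (N : ℝ) ^ ((2 : ℝ) / 3))) =
      ∫ t, f t ∂(btEdgeMeasure h) := by
  obtain ⟨C, -, hC⟩ := exists_abs_le_of_hasCompactSupport hf hsupp
  set q := (N : ℝ) ^ (1 / 6 : ℝ) with hq
  have hN0 : (0 : ℝ) < N := Nat.cast_pos.2 hN
  have hq0 : 0 < q := Real.rpow_pos_of_pos hN0 _
  have h23 : (N : ℝ) ^ ((2 : ℝ) / 3) = q ^ 4 := by
    rw [hq, ← Real.rpow_mul_natCast hN0.le]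
    norm_num
  have hN6 : (N : ℝ) = q ^ 6 := rpow_sixth_pow N
  have hr : √N / 2 = 1 / (2 * q ^ 3) * N := by
    have : √(N : ℝ) = q ^ 3 := by
      rw [hN6, show q ^ 6 = (q ^ 3) ^ 2 by ring, Real.sqrt_sq (by positivity)]
    rw [this, hN6]
    field_simp
  have hs : 0 < 1 / (2 * q ^ 3) := by positivity
  have hZ : Zbt 2 N (√N / 2) = (1 / (2 * q ^ 3)) ^ (N ^ 2) * ∫ y, btWeight N N y := by
    have := integral_mul_btWeight_mul N hs N fun _ => 1
    simp only [one_mul] at this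
    rw [← this, hr]
    rfl
  have hR : ∀ x : Fin n → ℝ, Rbt 2 n N (√N / 2) x = N.factorial / (N - n).factorial *
      (Zbt 2 N (√N / 2))⁻¹ * ∫ y, btWeight N (√N / 2) (combine N n x y) := fun x => rfl
  have hcomb := integral_mul_integral_combine h (√N / 2)
    (F := fun x : Fin n → ℝ => f fun a => 2 * q ^ 4 * (x a - 1)) (hf.comp (by fun_prop)).measurable
    (C := C) (fun x => hC _)
  have hscale := integral_mul_btWeight_mul N hs N
    fun z => f fun a => 2 * q ^ 4 * (z (Fin.castLE h a) - 1)
  rw [← hr] at hscale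
  have hcov := integral_comp_add_mul (fun x : Fin n → ℝ => f (fun a => 2 * q ^ 4 * (x a - 1)) *
    Rbt 2 n N (√N / 2) x) (c := 1 / (2 * q ^ 4)) (by positivity) 1
  have hlhs : ∫ t : Fin n → ℝ, f t * (1 / (2 * (N : ℝ) ^ ((2 : ℝ) / 3))) ^ n *
        Rbt 2 n N (√N / 2) (fun i => 1 + t i / (2 * (N : ℝ) ^ ((2 : ℝ) / 3))) =
      ∫ x : Fin n → ℝ, f (fun a => 2 * q ^ 4 * (x a - 1)) * Rbt 2 n N (√N / 2) x := by
    rw [← hcov, ← integral_const_mul]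
    refine integral_congr_ae (Eventually.of_forall fun t => ?_)
    have e : (fun a => 2 * q ^ 4 * (1 + 1 / (2 * q ^ 4) * t a - 1)) = t := by
      funext a
      field_simp
      ring
    simp only [h23, e, div_eq_mul_one_div (t _), mul_comm (t _)]
    ring
  have hchart : ∀ y : Fin N → ℝ, (fun a => 2 * q ^ 4 *
      (((1 / (2 * q ^ 3)) • y) (Fin.castLE h a) - 1)) = edgeChart h y := fun y => by
    funext a
    simp only [edgeChart, Pi.smul_apply, smul_eq_mul, ← hq]
    field_simp
  rw [hlhs, integral_btEdgeMeasure h hf.measurable]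
  calc ∫ x : Fin n → ℝ, f (fun a => 2 * q ^ 4 * (x a - 1)) * Rbt 2 n N (√N / 2) x
      = N.factorial / (N - n).factorial * (Zbt 2 N (√N / 2))⁻¹ *
          ∫ x : Fin n → ℝ, f (fun a => 2 * q ^ 4 * (x a - 1)) *
            ∫ y, btWeight N (√N / 2) (combine N n x y) := by
        rw [← integral_const_mul]
        refine integral_congr_ae (Eventually.of_forall fun x => ?_)
        simp only [hR]
        ring
    _ = _ := by
        rw [hcomb, hscale, hZ]
        simp only [hchart]
        have := integral_btWeight_pos hN
        field_simp

lemma tendsto_dilMeasure_real_mul_pow (n : ℕ) {d : ℝ} (hd : 0 < d) :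
    Tendsto (fun N : ℕ => (dilMeasure N).real {s | d / (2 * ((N : ℝ) ^ (1 / 6 : ℝ)) ^ 4) < |s - 1|} *
      (N : ℝ) ^ n) atTop (𝓝 0) := by
  obtain ⟨A, hA⟩ := exists_dilMeasure_real_le
  have hlim : Tendsto (fun N : ℕ => |A| * (((N : ℝ) ^ (1 / 6 : ℝ)) ^ ((6 * (n + 1) : ℕ) : ℝ) *
      rexp (-(d ^ 2 / 16) * (N : ℝ) ^ (1 / 6 : ℝ)))) atTop (𝓝 0) := by
    rw [← mul_zero |A|]
    exact ((tendsto_rpow_mul_exp_neg_mul_atTop_nhds_zero _ _ (by positivity)).comp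
      tendsto_rpow_sixth).const_mul _
  refine squeeze_zero' (Eventually.of_forall fun N => by positivity) ?_ hlim
  filter_upwards [eventually_ge_atTop 1] with N hN
  set q := (N : ℝ) ^ (1 / 6 : ℝ) with hq
  have hq1 : 1 ≤ q := Real.one_le_rpow (by exact_mod_cast hN) (by norm_num)
  have hN6 : (N : ℝ) = q ^ 6 := rpow_sixth_pow N
  have hq0 : 0 < q := by linarith
  calc (dilMeasure N).real {s | d / (2 * q ^ 4) < |s - 1|} * (N : ℝ) ^ n
      ≤ (A * N * rexp (-((N : ℝ) ^ 2 * (d / (2 * q ^ 4)) ^ 2 / 4))) * (N : ℝ) ^ n := by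
        gcongr
        exact hA N hN _ (by positivity)
    _ = A * (q ^ (6 * (n + 1)) * rexp (-(d ^ 2 / 16) * q ^ 4)) := by
        have e : (N : ℝ) ^ 2 * (d / (2 * q ^ 4)) ^ 2 / 4 = d ^ 2 / 16 * q ^ 4 := by
          rw [hN6]
          field_simp
          ring
        rw [e, hN6, pow_mul, pow_succ, neg_mul]
        ring
    _ ≤ |A| * (q ^ (6 * (n + 1)) * rexp (-(d ^ 2 / 16) * q)) := by
        have : q ≤ q ^ 4 := le_self_pow₀ hq1 (by norm_num)
        have hA' : A ≤ |A| := le_abs_self A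
        have hexp : rexp (-(d ^ 2 / 16) * q ^ 4) ≤ rexp (-(d ^ 2 / 16) * q) := by
          rw [neg_mul, neg_mul]
          gcongr
        gcongr
    _ = _ := by rw [Real.rpow_natCast]

/-- Airy-kernel universality at the soft edge for the bounded trace GUE. -/
theorem bounded_trace_GUE_airy_at_edge (n : ℕ) (hn : 1 ≤ n)
    (f : (Fin n → ℝ) → ℝ) (hf : Continuous f) (hsupp : HasCompactSupport f) :
    Filter.Tendsto
      (fun N : ℕ => ∫ t : Fin n → ℝ,
        f t * (1 / (2 * (N : ℝ) ^ ((2:ℝ)/3))) ^ n *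
          Rbt 2 n N (Real.sqrt N / 2)
            (fun i => 1 + t i / (2 * (N : ℝ) ^ ((2:ℝ)/3))))
      atTop
      (𝓝 (∫ t : Fin n → ℝ,
        f t * Matrix.det (Matrix.of fun j k : Fin n => KAiry (t j) (t k)))) := by
  rw [← tendsto_add_atTop_iff_nat n]
  have hle : ∀ K : ℕ, n ≤ K + n := fun K => Nat.le_add_left n K
  have hpos : ∀ K : ℕ, 0 < K + n := fun K => hn.trans (hle K)
  have hshift : Tendsto (fun K : ℕ => K + n) atTop atTop := tendsto_add_atTop_nat n
  have : ∀ K, IsFiniteMeasure (btEdgeMeasure (hle K)) := fun K =>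
    isFiniteMeasure_btEdgeMeasure (hle K)
  have : ∀ K, IsProbabilityMeasure (dilMeasure (K + n)) := fun K =>
    isProbabilityMeasure_dilMeasure (hpos K)
  have ha : Tendsto (fun N : ℕ => 2 * ((N : ℝ) ^ (1 / 6 : ℝ)) ^ 4) atTop atTop :=
    ((tendsto_pow_atTop (by norm_num)).comp tendsto_rpow_sixth).const_mul_atTop two_pos
  simp_rw [fun K => integral_mul_Rbt (hle K) (hpos K) hf hsupp]
  refine tendsto_integral_of_edgeDilate (m := fun K => btEdgeMeasure (hle K))
    (p := fun K => dilMeasure (K + n)) (M := fun K => ((K + n : ℕ) : ℝ) ^ n)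
    (L := fun f => ∫ t : Fin n → ℝ, f t * Matrix.det (Matrix.of fun j k => KAiry (t j) (t k)))
    (ha.comp hshift) (Eventually.of_forall fun K => one_le_pow₀ (by exact_mod_cast hpos K))
    (Eventually.of_forall fun K => btEdgeMeasure_real_univ_le (hle K) (hpos K))
    (fun d hd => (tendsto_dilMeasure_real_mul_pow n hd).comp hshift) (fun g hg hgs => ?_) hf hsupp
  simp_rw [Function.comp_apply, fun K => integral_integral_edgeDilate (hle K) (hpos K) hg hgs]
  exact (tendsto_integral_det_edgeKernel n hg hgs).comp hshift
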